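/- Suppose gamma G is a unitary reflection coset in V = C^n, zeta is a complex root of unity, and M is the set of maximal eigenspaces of S'_zeta^V(gamma G). Then for all n >= 0, H~_n(U'_zeta^V(gamma G)) is isomorphic as a ZG-module to the direct sum over m in M of H~_{n-1}((S'_zeta^V(gamma G))_{>m}), which in turn is isomorphic as a ZG-module to the direct sum over a set of representatives m of the G-orbits on M of the induced modules Ind_{G_m}^G H~_{n-1}((S'_zeta^V(gamma G))_{>m}), where G_m is the stabiliser in G of m. -/

import Mathlib

/-! Ordered chains, the augmented simplicial chain complex of the order complex of a poset
(given by an arbitrary strict-order relation), reduced homology, and induced maps. -/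

/-- Ordered chains with `n` vertices with respect to a relation `r`
(the `(n-1)`-simplices of the order complex). -/
def OCh (α : Type*) (r : α → α → Prop) (n : ℕ) : Type _ :=
  {f : Fin n → α // ∀ ⦃i j : Fin n⦄, i < j → r (f i) (f j)}

/-- The augmented simplicial chain group with `n`-vertex chains as basis
(`n = 0` gives the augmentation degree `-1`). -/
abbrev ACh (α : Type*) (r : α → α → Prop) (n : ℕ) := OCh α r n →₀ ℤ

/-- The `i`-th face of an `(n+1)`-vertex ordered chain. -/
def OCh.face {α : Type*} {r : α → α → Prop} {n : ℕ} (c : OCh α r (n + 1)) (i : Fin (n + 1)) :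
    OCh α r n :=
  ⟨c.1 ∘ i.succAbove, fun _ _ h => c.2 (Fin.strictMono_succAbove i h)⟩

/-- The simplicial boundary map of the augmented chain complex. -/
noncomputable def bdry (α : Type*) (r : α → α → Prop) (n : ℕ) :
    ACh α r (n + 1) →ₗ[ℤ] ACh α r n :=
  Finsupp.lsum ℤ fun c => LinearMap.toSpanSingleton ℤ _
    (∑ i : Fin (n + 1), ((-1 : ℤ) ^ (i : ℕ)) • Finsupp.single (c.face i) (1 : ℤ))

/-- Augmented `n`-cycles (chains with `n+1` vertices). -/
noncomputable def cyc (α : Type*) (r : α → α → Prop) (n : ℕ) :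
    Submodule ℤ (ACh α r (n + 1)) := LinearMap.ker (bdry α r n)

/-- Augmented `n`-boundaries (chains with `n+1` vertices). -/
noncomputable def bdries (α : Type*) (r : α → α → Prop) (n : ℕ) :
    Submodule ℤ (ACh α r (n + 1)) := LinearMap.range (bdry α r (n + 1))

/-- Reduced simplicial homology `H̃ₙ` (over `ℤ`) of the order complex of `(α, r)`. -/
noncomputable abbrev redH (α : Type*) (r : α → α → Prop) (n : ℕ) :=
  cyc α r n ⧸ (bdries α r n).comap (cyc α r n).subtype

/-- Reduced homology in degree `-1`. -/
noncomputable abbrev redHneg (α : Type*) (r : α → α → Prop) :=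
  (⊤ : Submodule ℤ (ACh α r 0)) ⧸
    (LinearMap.range (bdry α r 0)).comap (⊤ : Submodule ℤ (ACh α r 0)).subtype

section maps

variable {α β : Type*} {rα : α → α → Prop} {rβ : β → β → Prop}

/-- The simplicial map on ordered chains induced by a relation-preserving map. -/
def cmap (f : α → β) (hf : ∀ ⦃a b⦄, rα a b → rβ (f a) (f b)) {n : ℕ} (c : OCh α rα n) :
    OCh β rβ n :=
  ⟨f ∘ c.1, fun _ _ h => hf (c.2 h)⟩

/-- The induced map on augmented chain groups. -/
noncomputable def cmapL (f : α → β) (hf : ∀ ⦃a b⦄, rα a b → rβ (f a) (f b)) (n : ℕ) :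
    ACh α rα n →ₗ[ℤ] ACh β rβ n :=
  Finsupp.lmapDomain ℤ ℤ (cmap f hf)

theorem bdry_single {n : ℕ} (c : OCh α rα (n + 1)) (b : ℤ) :
    bdry α rα n (Finsupp.single c b) =
      b • ∑ i : Fin (n + 1), ((-1 : ℤ) ^ (i : ℕ)) • Finsupp.single (c.face i) (1 : ℤ) := by
  simp [bdry, Finsupp.lsum_single, LinearMap.toSpanSingleton_apply]

theorem face_cmap (f : α → β) (hf : ∀ ⦃a b⦄, rα a b → rβ (f a) (f b)) {n : ℕ}
    (c : OCh α rα (n + 1)) (i : Fin (n + 1)) :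
    (cmap f hf c).face i = cmap f hf (c.face i) := rfl

/-- Naturality of the boundary map. -/
theorem bdry_cmapL (f : α → β) (hf : ∀ ⦃a b⦄, rα a b → rβ (f a) (f b)) (n : ℕ) :
    (bdry β rβ n).comp (cmapL f hf (n + 1)) = (cmapL f hf n).comp (bdry α rα n) := by
  refine Finsupp.lhom_ext fun c b => ?_
  simp only [LinearMap.comp_apply, cmapL, Finsupp.lmapDomain_apply, Finsupp.mapDomain_single,
    bdry_single]
  rw [← Finsupp.lmapDomain_apply ℤ ℤ (cmap f hf), map_smul, map_sum]
  simp [Finsupp.lmapDomain_apply, Finsupp.mapDomain_single, face_cmap]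

theorem cmapL_mem_cyc (f : α → β) (hf : ∀ ⦃a b⦄, rα a b → rβ (f a) (f b)) {n : ℕ}
    {z : ACh α rα (n + 1)} (hz : z ∈ cyc α rα n) :
    cmapL f hf (n + 1) z ∈ cyc β rβ n := by
  have := congrArg (fun φ : ACh α rα (n+1) →ₗ[ℤ] ACh β rβ n => φ z) (bdry_cmapL f hf n)
  simp only [LinearMap.comp_apply] at this
  simp only [cyc, LinearMap.mem_ker] at hz ⊢
  rw [this, hz, map_zero]

/-- The induced map on reduced homology of a relation-preserving map. -/
noncomputable def indH (f : α → β) (hf : ∀ ⦃a b⦄, rα a b → rβ (f a) (f b)) (n : ℕ) :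
    redH α rα n →ₗ[ℤ] redH β rβ n :=
  Submodule.mapQ _ _
    ((cmapL f hf (n + 1)).restrict (fun _ hz => cmapL_mem_cyc f hf hz))
    (by
      rintro ⟨z, hz⟩ hmem
      simp only [Submodule.mem_comap, bdries, LinearMap.mem_range] at hmem ⊢
      obtain ⟨w, hw⟩ := hmem
      refine ⟨cmapL f hf (n + 2) w, ?_⟩
      have := congrArg (fun φ : ACh α rα (n+2) →ₗ[ℤ] ACh β rβ (n+1) => φ w) (bdry_cmapL f hf (n+1))
      simp only [LinearMap.comp_apply] at this
      simp only [LinearMap.restrict_apply]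
      rw [this, hw]
      rfl)

/-- The induced map on reduced homology in degree `-1`. -/
noncomputable def indHneg (f : α → β) (hf : ∀ ⦃a b⦄, rα a b → rβ (f a) (f b)) :
    redHneg α rα →ₗ[ℤ] redHneg β rβ :=
  Submodule.mapQ _ _ ((cmapL f hf 0).restrict (fun _ _ => Submodule.mem_top))
    (by
      rintro ⟨z, hz⟩ hmem
      simp only [Submodule.mem_comap, LinearMap.mem_range] at hmem ⊢
      obtain ⟨w, hw⟩ := hmem
      refine ⟨cmapL f hf 1 w, ?_⟩
      have := congrArg (fun φ : ACh α rα 1 →ₗ[ℤ] ACh β rβ 0 => φ w) (bdry_cmapL f hf 0)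
      simp only [LinearMap.comp_apply] at this
      simp only [LinearMap.restrict_apply]
      rw [this, hw]
      rfl)

/-- Coning off chains with a new bottom vertex `b`. -/
def coneMap (f : α → β) (hf : ∀ ⦃a b⦄, rα a b → rβ (f a) (f b)) (b : β)
    (hb : ∀ a : α, rβ b (f a)) {n : ℕ} (c : OCh α rα n) : OCh β rβ (n + 1) :=
  ⟨Fin.cons b (f ∘ c.1), by
    intro i j hij
    rcases Fin.eq_zero_or_eq_succ j with hj | ⟨j', rfl⟩
    · subst hj; exact absurd hij (Fin.not_lt_zero i)
    · rcases Fin.eq_zero_or_eq_succ i with hi | ⟨i', rfl⟩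
      · subst hi; simpa using hb (c.1 j')
      · have h' : i' < j' := by simpa using hij
        simpa using hf (c.2 h')⟩

/-- The linear extension of `coneMap` to chain groups: `z ↦ b * z`. -/
noncomputable def coneL (f : α → β) (hf : ∀ ⦃a b⦄, rα a b → rβ (f a) (f b)) (b : β)
    (hb : ∀ a : α, rβ b (f a)) (n : ℕ) : ACh α rα n →ₗ[ℤ] ACh β rβ (n + 1) :=
  Finsupp.lmapDomain ℤ ℤ (coneMap f hf b hb)

end maps

section PosetConstructions

/-- The strict order of the poset `P_Q` on `Option P`, where `none` plays the role of the
adjoined minimal element `0̂_Q` lying below exactly the elements of `Q`. -/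
def extRel {P : Type*} (rP : P → P → Prop) (Q : Set P) : Option P → Option P → Prop
  | some x, some y => rP x y
  | none, some y => y ∈ Q
  | _, none => False

/-- The strict order of the poset suspension `Σ R` on `Bool ⊕ R`; `Sum.inl false` and
`Sum.inl true` are the two adjoined elements `0̂_R` and `0̂'_R`, lying below every element
of `R` and incomparable with each other. -/
def suspRel {R : Type*} (rR : R → R → Prop) : Bool ⊕ R → Bool ⊕ R → Prop
  | Sum.inl _, Sum.inr _ => True
  | Sum.inr a, Sum.inr b => rR a b
  | _, _ => False

/-- The underlying set of the wedge of suspensions `⋁_{t ∈ T} Σ Rₜ`: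
`none` is the adjoined minimal element `0̂`, `some (Sum.inl t)` is the element `t ∈ T`, and
`some (Sum.inr ⟨t, x⟩)` is the element `(x, t) ∈ Rₜ × {t}`. -/
abbrev WedgeP (T : Type*) (R : T → Type*) := Option (T ⊕ Σ t, R t)

/-- The strict order of the wedge of suspensions of the posets `Rₜ`. -/
def wRel {T : Type*} {R : T → Type*} (r : ∀ t, R t → R t → Prop) :
    WedgeP T R → WedgeP T R → Prop
  | none, some (Sum.inr _) => True
  | some (Sum.inl t), some (Sum.inr b) => t = b.1
  | some (Sum.inr a), some (Sum.inr b) => ∃ h : a.1 = b.1, r b.1 (h ▸ a.2) b.2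
  | _, _ => False

/-- The order complex of `(α, r)` restricted to the vertex set `S`: the abstract simplicial
complex whose simplices are the finite chains contained in `S`. -/
def cpx (α : Type*) (r : α → α → Prop) (S : Set α) : Set (Finset α) :=
  {s | ↑s ⊆ S ∧ ∀ a ∈ s, ∀ b ∈ s, a ≠ b → r a b ∨ r b a}

/-- The full order complex of `(α, r)`. -/
abbrev fullCpx (α : Type*) (r : α → α → Prop) : Set (Finset α) := cpx α r Set.univ

theorem empty_mem_cpx (α : Type*) (r : α → α → Prop) (S : Set α) : ∅ ∈ cpx α r S := by
  simp [cpx]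

/-- The length of the poset `(α, r)`: the supremum of the lengths of its chains. -/
noncomputable def posetLength (α : Type*) (r : α → α → Prop) : ℕ :=
  sSup {k : ℕ | Nonempty {f : Fin (k+1) → α // ∀ ⦃i j : Fin (k+1)⦄, i < j → r (f i) (f j)}}

theorem extRel_map_QQ {P : Type*} {rP : P → P → Prop} {Q : Set P} :
    ∀ ⦃a b : Option ↥Q⦄,
      extRel (fun x y : ↥Q => rP x y) Set.univ a b →
        extRel rP Q (Option.map Subtype.val a) (Option.map Subtype.val b) := by
  intro a b h
  match a, b with
  | none, some b => exact b.2
  | some a, some b => exact h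
  | none, none => exact h.elim
  | some _, none => exact h.elim

theorem extRel_optionMap {P : Type*} {rP : P → P → Prop} {Q : Set P} {f : P → P}
    (hf : ∀ ⦃a b⦄, rP a b → rP (f a) (f b)) (hfQ : ∀ ⦃q⦄, q ∈ Q → f q ∈ Q) :
    ∀ ⦃a b : Option P⦄, extRel rP Q a b → extRel rP Q (Option.map f a) (Option.map f b) := by
  intro a b h
  match a, b with
  | none, some b => exact hfQ h
  | some a, some b => exact hf h
  | none, none => exact h.elim
  | some _, none => exact h.elim

theorem suspRel_map {R : Type*} {rR : R → R → Prop} {f : R → R}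
    (hf : ∀ ⦃a b⦄, rR a b → rR (f a) (f b)) :
    ∀ ⦃a b : Bool ⊕ R⦄, suspRel rR a b → suspRel rR (Sum.map id f a) (Sum.map id f b) := by
  intro a b h
  match a, b with
  | Sum.inl x, Sum.inr b => trivial
  | Sum.inr a, Sum.inr b => exact hf h
  | Sum.inl x, Sum.inl y => exact h.elim
  | Sum.inr a, Sum.inl y => exact h.elim

theorem wRel_map {T : Type*} {R : T → Type*} {r : ∀ t, R t → R t → Prop}
    (fT : T → T) (fR : ∀ t, R t → R (fT t))
    (hf : ∀ (t : T) ⦃a b : R t⦄, r t a b → r (fT t) (fR t a) (fR t b)) :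
    ∀ ⦃a b : WedgeP T R⦄, wRel r a b →
      wRel r (Option.map (Sum.map fT (fun p => ⟨fT p.1, fR p.1 p.2⟩)) a)
        (Option.map (Sum.map fT (fun p => ⟨fT p.1, fR p.1 p.2⟩)) b) := by
  rintro (_ | (t | ⟨t, x⟩)) (_ | (t' | ⟨t', y⟩)) h <;> try exact h.elim
  · trivial
  · exact congrArg fT h
  · obtain ⟨ht, hr⟩ := h
    dsimp only at ht hr
    subst ht
    exact ⟨rfl, hf t hr⟩

end PosetConstructions

section IndModel

/-- A concrete model of the induced module `Ind_H^G N` (for `H` the subgroup of `G`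
given by the subset `stab`, acting on `N` via `ρ`): functions `f : G → N` satisfying
`f (g * h) = ρ h⁻¹ (f g)`. -/
noncomputable def IndSubG {G' : Type*} [Group G'] {N : Type*} [AddCommGroup N]
    (stab : Set G') (ρ : ∀ h : G', h ∈ stab → (N →+ N)) : AddSubgroup (G' → N) where
  carrier := {f | ∀ (g h : G') (hh : h ∈ stab) (hh' : h⁻¹ ∈ stab), f (g * h) = ρ h⁻¹ hh' (f g)}
  add_mem' := by
    intro f f' hf hf' g h hh hh'
    simp [hf g h hh hh', hf' g h hh hh']
  zero_mem' := by intro g h hh hh'; simp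
  neg_mem' := by
    intro f hf g h hh hh'
    simp [hf g h hh hh']

/-- Left translation action of `G` on the induced module model. -/
noncomputable def indTrans {G' : Type*} [Group G'] {N : Type*} [AddCommGroup N]
    (stab : Set G') (ρ : ∀ h : G', h ∈ stab → (N →+ N)) (g₀ : G') :
    ↥(IndSubG stab ρ) →+ ↥(IndSubG stab ρ) where
  toFun f := ⟨fun x => f.1 (g₀⁻¹ * x), by
    intro g h hh hh'
    simpa [mul_assoc] using f.2 (g₀⁻¹ * g) h hh hh'⟩
  map_zero' := Subtype.ext rfl
  map_add' _ _ := Subtype.ext rfl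

end IndModel

section ReflectionGroups

/-- The `ζ`-eigenspace `V(x, ζ)` of `x ∈ GL(V)` acting on `V = ℂⁿ`. -/
noncomputable def eigSp {n : ℕ} (x : Matrix.GeneralLinearGroup (Fin n) ℂ) (ζ : ℂ) :
    Submodule ℂ (Fin n → ℂ) :=
  Module.End.eigenspace (Matrix.toLin' (x : Matrix (Fin n) (Fin n) ℂ)) ζ

/-- The fixed subspace of `g`. -/
noncomputable def fixSp {n : ℕ} (g : Matrix.GeneralLinearGroup (Fin n) ℂ) :
    Submodule ℂ (Fin n → ℂ) := eigSp g 1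

/-- A reflection: a non-identity element whose fixed subspace is a hyperplane. -/
def IsReflection {n : ℕ} (g : Matrix.GeneralLinearGroup (Fin n) ℂ) : Prop :=
  g ≠ 1 ∧ Module.finrank ℂ (fixSp g) = n - 1

/-- A (finite) unitary reflection group in `V = ℂⁿ`. -/
def IsUnitaryReflectionGroup {n : ℕ} (G : Subgroup (Matrix.GeneralLinearGroup (Fin n) ℂ)) :
    Prop :=
  (G : Set (Matrix.GeneralLinearGroup (Fin n) ℂ)).Finite ∧
  (∀ g ∈ G, (g : Matrix (Fin n) (Fin n) ℂ) ∈ Matrix.unitaryGroup (Fin n) ℂ) ∧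
  Subgroup.closure {g | g ∈ G ∧ IsReflection g} = G

/-- `γ` normalises `G`. -/
def Normalises {n : ℕ} (γ : Matrix.GeneralLinearGroup (Fin n) ℂ)
    (G : Subgroup (Matrix.GeneralLinearGroup (Fin n) ℂ)) : Prop :=
  ∀ g, g ∈ G ↔ γ * g * γ⁻¹ ∈ G

/-- The poset `S_ζ^V(γG)` of `ζ`-eigenspaces of elements of the reflection coset `γG`,
to be ordered by the *reverse* of inclusion. -/
def Sset {n : ℕ} (γ : Matrix.GeneralLinearGroup (Fin n) ℂ)
    (G : Subgroup (Matrix.GeneralLinearGroup (Fin n) ℂ)) (ζ : ℂ) :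
    Set (Submodule ℂ (Fin n → ℂ)) :=
  {E | ∃ g ∈ G, E = eigSp (γ * g) ζ}

/-- `S'_ζ^V(γG)`: `S_ζ^V(γG)` with the unique maximal element `1̂` (the smallest eigenspace)
removed. -/
def Sp {n : ℕ} (γ : Matrix.GeneralLinearGroup (Fin n) ℂ)
    (G : Subgroup (Matrix.GeneralLinearGroup (Fin n) ℂ)) (ζ : ℂ) :
    Set (Submodule ℂ (Fin n → ℂ)) :=
  {E ∈ Sset γ G ζ | ∃ F ∈ Sset γ G ζ, ¬ E ≤ F}

/-- `S̃_ζ^V(γG)`: `S_ζ^V(γG)` with the unique maximal element removed, and the unique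
minimal element removed if it exists. -/
def Stilde {n : ℕ} (γ : Matrix.GeneralLinearGroup (Fin n) ℂ)
    (G : Subgroup (Matrix.GeneralLinearGroup (Fin n) ℂ)) (ζ : ℂ) :
    Set (Submodule ℂ (Fin n → ℂ)) :=
  {E ∈ Sset γ G ζ | (∃ F ∈ Sset γ G ζ, ¬ E ≤ F) ∧ (∃ F ∈ Sset γ G ζ, ¬ F ≤ E)}

/-- `T'_ζ^V(γG)`: the non-maximal eigenspaces of `S'_ζ^V(γG)`. -/
def Tp {n : ℕ} (γ : Matrix.GeneralLinearGroup (Fin n) ℂ)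
    (G : Subgroup (Matrix.GeneralLinearGroup (Fin n) ℂ)) (ζ : ℂ) :
    Set (Submodule ℂ (Fin n → ℂ)) :=
  {E ∈ Sp γ G ζ | ∃ F ∈ Sp γ G ζ, E < F}

/-- The set of maximal eigenspaces, `M = S' \ T'`. -/
def Mp {n : ℕ} (γ : Matrix.GeneralLinearGroup (Fin n) ℂ)
    (G : Subgroup (Matrix.GeneralLinearGroup (Fin n) ℂ)) (ζ : ℂ) :
    Set (Submodule ℂ (Fin n → ℂ)) :=
  {E ∈ Sp γ G ζ | ∀ F ∈ Sp γ G ζ, ¬ E < F}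

/-- The strict order of `S'_ζ^V(γG)` (reverse inclusion). -/
def rSp {n : ℕ} (γ : Matrix.GeneralLinearGroup (Fin n) ℂ)
    (G : Subgroup (Matrix.GeneralLinearGroup (Fin n) ℂ)) (ζ : ℂ) :
    ↥(Sp γ G ζ) → ↥(Sp γ G ζ) → Prop :=
  fun E F => F.1 < E.1

/-- The strict order of `U'_ζ^V(γG)` on `Option ↥(S'_ζ^V(γG))`, where `none` is the adjoined
element `0̂_S` lying below exactly the elements of `T'_ζ^V(γG)`. -/
def Urel {n : ℕ} (γ : Matrix.GeneralLinearGroup (Fin n) ℂ)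
    (G : Subgroup (Matrix.GeneralLinearGroup (Fin n) ℂ)) (ζ : ℂ) :
    Option ↥(Sp γ G ζ) → Option ↥(Sp γ G ζ) → Prop
  | some E, some F => F.1 < E.1
  | none, some F => F.1 ∈ Tp γ G ζ
  | _, none => False

end ReflectionGroups

/-- The matrix of an element of a subgroup of `GL(n, ℂ)`. -/
noncomputable abbrev matOf {n : ℕ} {G : Subgroup (Matrix.GeneralLinearGroup (Fin n) ℂ)}
    (g : ↥G) : Matrix (Fin n) (Fin n) ℂ :=
  ((g : Matrix.GeneralLinearGroup (Fin n) ℂ) : Matrix (Fin n) (Fin n) ℂ)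

/-- The subset of `↥(S'_ζᵛ(γG))` corresponding to the set `M` of maximal eigenspaces. -/
def MpSub {n : ℕ} (γ : Matrix.GeneralLinearGroup (Fin n) ℂ)
    (G : Subgroup (Matrix.GeneralLinearGroup (Fin n) ℂ)) (ζ : ℂ) : Set ↥(Sp γ G ζ) :=
  {E : ↥(Sp γ G ζ) | (E : Submodule ℂ (Fin n → ℂ)) ∈ Mp γ G ζ}

/-- The subposet `(S'_ζᵛ(γG))_{> m}` of elements strictly above `m ∈ M`. -/
abbrev SgtT {n : ℕ} (γ : Matrix.GeneralLinearGroup (Fin n) ℂ)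
    (G : Subgroup (Matrix.GeneralLinearGroup (Fin n) ℂ)) (ζ : ℂ) (m : ↥(MpSub γ G ζ)) :=
  {E : ↥(Sp γ G ζ) // rSp γ G ζ (m : ↥(Sp γ G ζ)) E}

/-- The order of `(S'_ζᵛ(γG))_{> m}`. -/
def rgtS {n : ℕ} (γ : Matrix.GeneralLinearGroup (Fin n) ℂ)
    (G : Subgroup (Matrix.GeneralLinearGroup (Fin n) ℂ)) (ζ : ℂ) (m : ↥(MpSub γ G ζ)) :
    SgtT γ G ζ m → SgtT γ G ζ m → Prop :=
  fun a b => rSp γ G ζ a.1 b.1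

noncomputable instance {n : ℕ} : DecidableEq (Submodule ℂ (Fin n → ℂ)) :=
  Classical.decEq _

/-- The stabiliser `G_m` of a maximal eigenspace `m ∈ M`, as a subset of `G`. -/
def stabE {n : ℕ} {γ : Matrix.GeneralLinearGroup (Fin n) ℂ}
    {G : Subgroup (Matrix.GeneralLinearGroup (Fin n) ℂ)} {ζ : ℂ}
    (m : ↥(MpSub γ G ζ)) : Set ↥G :=
  {h : ↥G | Submodule.map (Matrix.toLin' (matOf h))
      ((m : ↥(Sp γ G ζ)) : Submodule ℂ (Fin n → ℂ)) =
    ((m : ↥(Sp γ G ζ)) : Submodule ℂ (Fin n → ℂ))}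

set_option maxHeartbeats 2000000
set_option synthInstance.maxHeartbeats 1000000

open scoped DirectSum

section Functoriality

variable {α β δ : Type*} {rα : α → α → Prop} {rβ : β → β → Prop} {rδ : δ → δ → Prop}

theorem cmapL_single (f : α → β) (hf : ∀ ⦃a b⦄, rα a b → rβ (f a) (f b)) {n : ℕ}
    (c : OCh α rα n) (a : ℤ) :
    cmapL f hf n (Finsupp.single c a) = Finsupp.single (cmap f hf c) a :=
  Finsupp.mapDomain_single

theorem coneL_single (f : α → β) (hf : ∀ ⦃a b⦄, rα a b → rβ (f a) (f b)) (b : β)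
    (hb : ∀ a : α, rβ b (f a)) {n : ℕ} (c : OCh α rα n) (a : ℤ) :
    coneL f hf b hb n (Finsupp.single c a) = Finsupp.single (coneMap f hf b hb c) a :=
  Finsupp.mapDomain_single

theorem cmapL_id (hf : ∀ ⦃a b⦄, rα a b → rα (id a) (id b)) (n : ℕ) (x : ACh α rα n) :
    cmapL id hf n x = x :=
  Finsupp.mapDomain_id

theorem cmapL_comp (f : α → β) (hf : ∀ ⦃a b⦄, rα a b → rβ (f a) (f b))
    (g : β → δ) (hg : ∀ ⦃a b⦄, rβ a b → rδ (g a) (g b))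
    (hgf : ∀ ⦃a b⦄, rα a b → rδ ((g ∘ f) a) ((g ∘ f) b)) (n : ℕ) (x : ACh α rα n) :
    cmapL (g ∘ f) hgf n x = cmapL g hg n (cmapL f hf n x) :=
  Finsupp.mapDomain_comp (f := cmap f hf) (g := cmap g hg)

theorem indH_mk (f : α → β) (hf : ∀ ⦃a b⦄, rα a b → rβ (f a) (f b)) (n : ℕ)
    (z : cyc α rα n) :
    indH f hf n (Submodule.Quotient.mk z) =
      Submodule.Quotient.mk ⟨cmapL f hf (n + 1) z, cmapL_mem_cyc f hf z.2⟩ := rfl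

theorem indHneg_mk (f : α → β) (hf : ∀ ⦃a b⦄, rα a b → rβ (f a) (f b))
    (z : (⊤ : Submodule ℤ (ACh α rα 0))) :
    indHneg f hf (Submodule.Quotient.mk z) =
      Submodule.Quotient.mk ⟨cmapL f hf 0 z, Submodule.mem_top⟩ := rfl

theorem indH_congr {f g : α → β} (h : f = g) (hf : ∀ ⦃a b⦄, rα a b → rβ (f a) (f b))
    (hg : ∀ ⦃a b⦄, rα a b → rβ (g a) (g b)) (n : ℕ) (x : redH α rα n) :
    indH f hf n x = indH g hg n x := by
  subst h
  rfl

theorem indHneg_congr {f g : α → β} (h : f = g) (hf : ∀ ⦃a b⦄, rα a b → rβ (f a) (f b))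
    (hg : ∀ ⦃a b⦄, rα a b → rβ (g a) (g b)) (x : redHneg α rα) :
    indHneg f hf x = indHneg g hg x := by
  subst h
  rfl

theorem indH_id (hf : ∀ ⦃a b⦄, rα a b → rα (id a) (id b)) (n : ℕ) (x : redH α rα n) :
    indH id hf n x = x := by
  obtain ⟨z, rfl⟩ := Submodule.Quotient.mk_surjective _ x
  rw [indH_mk]
  exact congrArg _ (Subtype.ext (cmapL_id hf _ _))

theorem indH_comp (f : α → β) (hf : ∀ ⦃a b⦄, rα a b → rβ (f a) (f b))
    (g : β → δ) (hg : ∀ ⦃a b⦄, rβ a b → rδ (g a) (g b))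
    (hgf : ∀ ⦃a b⦄, rα a b → rδ ((g ∘ f) a) ((g ∘ f) b)) (n : ℕ) (x : redH α rα n) :
    indH (g ∘ f) hgf n x = indH g hg n (indH f hf n x) := by
  obtain ⟨z, rfl⟩ := Submodule.Quotient.mk_surjective _ x
  rw [indH_mk, indH_mk, indH_mk]
  exact congrArg _ (Subtype.ext (cmapL_comp f hf g hg hgf _ _))

theorem indHneg_id (hf : ∀ ⦃a b⦄, rα a b → rα (id a) (id b)) (x : redHneg α rα) :
    indHneg id hf x = x := by
  obtain ⟨z, rfl⟩ := Submodule.Quotient.mk_surjective _ x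
  rw [indHneg_mk]
  exact congrArg _ (Subtype.ext (cmapL_id hf _ _))

theorem indHneg_comp (f : α → β) (hf : ∀ ⦃a b⦄, rα a b → rβ (f a) (f b))
    (g : β → δ) (hg : ∀ ⦃a b⦄, rβ a b → rδ (g a) (g b))
    (hgf : ∀ ⦃a b⦄, rα a b → rδ ((g ∘ f) a) ((g ∘ f) b)) (x : redHneg α rα) :
    indHneg (g ∘ f) hgf x = indHneg g hg (indHneg f hf x) := by
  obtain ⟨z, rfl⟩ := Submodule.Quotient.mk_surjective _ x
  rw [indHneg_mk, indHneg_mk, indHneg_mk]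
  exact congrArg _ (Subtype.ext (cmapL_comp f hf g hg hgf _ _))

end Functoriality

section Cones

variable {α β : Type*} {rα : α → α → Prop} {rβ : β → β → Prop}

theorem cmap_injective {f : α → β} (hf : ∀ ⦃a b⦄, rα a b → rβ (f a) (f b))
    (hinj : Function.Injective f) (n : ℕ) :
    Function.Injective (cmap (rα := rα) (rβ := rβ) f hf (n := n)) := by
  intro c d h
  exact Subtype.ext (hinj.comp_left (congrArg Subtype.val h))

theorem coneMap_injective {f : α → β} (hf : ∀ ⦃a b⦄, rα a b → rβ (f a) (f b)) {b : β}
    (hb : ∀ a : α, rβ b (f a)) (hinj : Function.Injective f) (n : ℕ) :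
    Function.Injective (coneMap (rα := rα) (rβ := rβ) f hf b hb (n := n)) := by
  intro c d h
  have h' : (Fin.cons b (f ∘ c.1) : Fin (n + 1) → β) = Fin.cons b (f ∘ d.1) :=
    congrArg Subtype.val h
  exact Subtype.ext (hinj.comp_left (Fin.cons_injective2 h').2)

theorem face_zero_coneMap (f : α → β) (hf : ∀ ⦃a b⦄, rα a b → rβ (f a) (f b)) (b : β)
    (hb : ∀ a : α, rβ b (f a)) {n : ℕ} (c : OCh α rα n) :
    (coneMap f hf b hb c).face 0 = cmap f hf c := by
  refine Subtype.ext (funext fun i => ?_)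
  simp [OCh.face, coneMap, cmap]

theorem face_succ_coneMap (f : α → β) (hf : ∀ ⦃a b⦄, rα a b → rβ (f a) (f b)) (b : β)
    (hb : ∀ a : α, rβ b (f a)) {n : ℕ} (c : OCh α rα (n + 1)) (i : Fin (n + 1)) :
    (coneMap f hf b hb c).face i.succ = coneMap f hf b hb (c.face i) := by
  refine Subtype.ext (funext fun j => ?_)
  refine Fin.cases ?_ (fun j => ?_) j <;> simp [OCh.face, coneMap, Fin.removeNth]

/-- The boundary of the cone over a `(-1)`-chain. -/
theorem bdry_coneL_zero (f : α → β) (hf : ∀ ⦃a b⦄, rα a b → rβ (f a) (f b)) (b : β)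
    (hb : ∀ a : α, rβ b (f a)) (z : ACh α rα 0) :
    bdry β rβ 0 (coneL f hf b hb 0 z) = cmapL f hf 0 z := by
  induction z using Finsupp.induction_linear with
  | zero => simp
  | add x y hx hy => simp only [map_add, hx, hy]
  | single c a =>
    rw [coneL_single, bdry_single, cmapL_single]
    simp [face_zero_coneMap]

/-- The boundary of the cone over a chain of nonnegative degree. -/
theorem bdry_coneL_succ (f : α → β) (hf : ∀ ⦃a b⦄, rα a b → rβ (f a) (f b)) (b : β)
    (hb : ∀ a : α, rβ b (f a)) (n : ℕ) (z : ACh α rα (n + 1)) :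
    bdry β rβ (n + 1) (coneL f hf b hb (n + 1) z) =
      cmapL f hf (n + 1) z - coneL f hf b hb n (bdry α rα n z) := by
  induction z using Finsupp.induction_linear with
  | zero => simp
  | add x y hx hy => simp only [map_add, hx, hy]; abel
  | single c a =>
    rw [coneL_single, bdry_single, cmapL_single, bdry_single, Fin.sum_univ_succ]
    simp only [map_smul, map_sum, coneL_single, face_zero_coneMap, face_succ_coneMap,
      smul_add, Fin.val_zero, pow_zero, one_smul, Finsupp.smul_single, smul_eq_mul, mul_one,
      Fin.val_succ, pow_succ, mul_neg, sub_eq_add_neg, Finsupp.single_neg,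
      Finset.sum_neg_distrib, smul_neg]

end Cones

section Comap

variable {X Y Z : Type*}

theorem lcomapDomain_lmapDomain_self {f : X → Y} (hf : Function.Injective f) (x : X →₀ ℤ) :
    Finsupp.lcomapDomain (R := ℤ) f hf (Finsupp.lmapDomain ℤ ℤ f x) = x :=
  Finsupp.comapDomain_mapDomain f hf x

theorem lcomapDomain_lmapDomain_of_ne {f : X → Y} (hf : Function.Injective f) {g : Z → Y}
    (hfg : ∀ x z, f x ≠ g z) (z : Z →₀ ℤ) :
    Finsupp.lcomapDomain (R := ℤ) f hf (Finsupp.lmapDomain ℤ ℤ g z) = 0 := by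
  ext x
  refine Finsupp.mapDomain_of_notMem_range z (f x) ?_
  rintro ⟨z, hz⟩
  exact hfg x z hz.symm

end Comap

section Retract

/-- Passing to quotients a deformation retraction of cycles modulo boundaries onto a finite
product. -/
theorem exists_quotient_equiv_pi {M A : Type*} [Fintype M] [DecidableEq M] [AddCommGroup A]
    {C : M → Type*} [∀ m, AddCommGroup (C m)] (Z B : Submodule ℤ A)
    (Z' B' : ∀ m, Submodule ℤ (C m)) (ρ : ∀ m, A →ₗ[ℤ] C m) (j : ∀ m, C m →ₗ[ℤ] A)
    (hρZ : ∀ m, ∀ z ∈ Z, ρ m z ∈ Z' m) (hρB : ∀ m, ∀ z ∈ B, ρ m z ∈ B' m)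
    (hjZ : ∀ m, ∀ z ∈ Z' m, j m z ∈ Z) (hjB : ∀ m, ∀ z ∈ B' m, j m z ∈ B)
    (hself : ∀ m z, ρ m (j m z) = z) (hne : ∀ m m' z, m ≠ m' → ρ m (j m' z) = 0)
    (hhom : ∀ z ∈ Z, z - ∑ m, j m (ρ m z) ∈ B) :
    ∃ e : (Z ⧸ B.comap Z.subtype) ≃+ ∀ m, Z' m ⧸ (B' m).comap (Z' m).subtype,
      ∀ (z : Z) (m : M), e (Submodule.Quotient.mk z) m =
        Submodule.Quotient.mk ⟨ρ m z, hρZ m z z.2⟩ := by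
  let F : (Z ⧸ B.comap Z.subtype) →ₗ[ℤ] ∀ m, Z' m ⧸ (B' m).comap (Z' m).subtype :=
    LinearMap.pi fun m => Submodule.mapQ _ _ ((ρ m).restrict (hρZ m)) fun z hz => hρB m z hz
  have hF : ∀ (z : Z) (m : M), F (Submodule.Quotient.mk z) m =
      Submodule.Quotient.mk ⟨ρ m z, hρZ m z z.2⟩ := fun z m => rfl
  refine ⟨AddEquiv.ofBijective F.toAddMonoidHom ⟨?_, ?_⟩, hF⟩
  · refine (injective_iff_map_eq_zero _).2 fun x hx => ?_
    obtain ⟨z, rfl⟩ := Submodule.Quotient.mk_surjective _ x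
    refine (Submodule.Quotient.mk_eq_zero _).2 ?_
    have hm : ∀ m, ρ m z ∈ B' m := fun m =>
      (Submodule.Quotient.mk_eq_zero ((B' m).comap (Z' m).subtype)).1
        ((hF z m).symm.trans (congrFun hx m))
    have := B.add_mem (hhom z z.2) (B.sum_mem fun m (_ : m ∈ Finset.univ) => hjB m _ (hm m))
    simpa using this
  · intro y
    choose w hw using fun m => Submodule.Quotient.mk_surjective _ (y m)
    refine ⟨Submodule.Quotient.mk ⟨∑ m, j m (w m), Z.sum_mem fun m _ => hjZ m _ (w m).2⟩,
      funext fun m => ?_⟩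
    refine (hF _ m).trans ((congrArg _ (Subtype.ext ?_)).trans (hw m))
    change ρ m (∑ i, j i (w i)) = w m
    rw [map_sum, Finset.sum_eq_single m, hself]
    · intro b _ hb
      exact hne _ _ _ hb.symm
    · simp

end Retract

section MinimalVertices

variable {P : Type*} {r : P → P → Prop} {Q : Set P}

theorem extRel_some_val (s : Set P) : ∀ ⦃a b : s⦄, r a b →
    extRel r Q (some a.1) (some b.1) := fun _ _ h => h

theorem extRel_none_val : ∀ a : Q, extRel r Q none (some a.1) := fun a => a.2

theorem extRel_vert_val (m : P) : ∀ a : {p | r m p}, extRel r Q (some m) (some a.1) :=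
  fun a => a.2

theorem some_val_injective (s : Set P) :
    Function.Injective fun a : s => (some a.1 : Option P) :=
  (Option.some_injective P).comp Subtype.val_injective

variable (r Q) in
/-- The inclusion of the chains in `Q` into the chains in `P_Q`. -/
noncomputable def inclQ (n : ℕ) :
    ACh Q (fun a b => r a b) n →ₗ[ℤ] ACh (Option P) (extRel r Q) n :=
  cmapL (fun a => some a.1) (extRel_some_val Q) n

variable (r Q) in
/-- The cone `z ↦ 0̂ * z` over chains in `Q`. -/
noncomputable def botL (n : ℕ) :
    ACh Q (fun a b => r a b) n →ₗ[ℤ] ACh (Option P) (extRel r Q) (n + 1) :=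
  coneL (fun a => some a.1) (extRel_some_val Q) none extRel_none_val n

variable (r Q) in
/-- The cone `z ↦ m * z` over chains in `P_{>m}`. -/
noncomputable def vertL (m : P) (n : ℕ) :
    ACh {p // r m p} (fun a b => r a.1 b.1) n →ₗ[ℤ] ACh (Option P) (extRel r Q) (n + 1) :=
  coneL (fun a => some a.1) (extRel_some_val {p | r m p}) (some m) (extRel_vert_val m) n

variable (r Q) in
/-- The projection onto the chains in `Q`. -/
noncomputable def projQ (n : ℕ) :
    ACh (Option P) (extRel r Q) n →ₗ[ℤ] ACh Q (fun a b => r a b) n :=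
  Finsupp.lcomapDomain _ (cmap_injective (extRel_some_val Q) (some_val_injective Q) n)

variable (r Q) in
/-- The residue at `m`: chains with bottom vertex `m` are sent to their remaining vertices, all
others to zero. -/
noncomputable def resL (m : P) (n : ℕ) :
    ACh (Option P) (extRel r Q) (n + 1) →ₗ[ℤ] ACh {p // r m p} (fun a b => r a.1 b.1) n :=
  Finsupp.lcomapDomain _ (coneMap_injective (extRel_some_val {p | r m p})
    (extRel_vert_val m) (some_val_injective _) n)

theorem projQ_inclQ (n : ℕ) (z) : projQ r Q n (inclQ r Q n z) = z :=
  lcomapDomain_lmapDomain_self _ z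

theorem projQ_botL (n : ℕ) (z) : projQ r Q (n + 1) (botL r Q n z) = 0 :=
  lcomapDomain_lmapDomain_of_ne _
    (fun _ _ h => Option.some_ne_none _ (congrFun (congrArg Subtype.val h) 0)) z

theorem projQ_vertL {m : P} (hm : m ∉ Q) (n : ℕ) (z) :
    projQ r Q (n + 1) (vertL r Q m n z) = 0 :=
  lcomapDomain_lmapDomain_of_ne _
    (fun c _ h => by
      have h0 : some (c.1 0).1 = some m := congrFun (congrArg Subtype.val h) 0
      exact hm (Option.some_injective _ h0 ▸ (c.1 0).2)) z

theorem resL_vertL_self (m : P) (n : ℕ) (z) : resL r Q m n (vertL r Q m n z) = z :=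
  lcomapDomain_lmapDomain_self _ z

theorem resL_vertL_of_ne {m m' : P} (h : m ≠ m') (n : ℕ) (z) :
    resL r Q m n (vertL r Q m' n z) = 0 :=
  lcomapDomain_lmapDomain_of_ne _
    (fun _ _ e => h (Option.some_injective _ (congrFun (congrArg Subtype.val e) 0))) z

theorem resL_botL (m : P) (n : ℕ) (z) : resL r Q m n (botL r Q n z) = 0 :=
  lcomapDomain_lmapDomain_of_ne _
    (fun _ _ e => Option.some_ne_none _ (congrFun (congrArg Subtype.val e) 0)) z

theorem resL_inclQ {m : P} (hm : m ∉ Q) (n : ℕ) (z) : resL r Q m n (inclQ r Q (n + 1) z) = 0 :=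
  lcomapDomain_lmapDomain_of_ne _
    (fun _ c e => by
      have h0 : some m = some (c.1 0).1 := congrFun (congrArg Subtype.val e) 0
      exact hm (Option.some_injective _ h0.symm ▸ (c.1 0).2)) z

theorem resL_single_of_ne (m : P) {n : ℕ} (c : OCh (Option P) (extRel r Q) (n + 1))
    (hc : c.1 0 ≠ some m) : resL r Q m n (Finsupp.single c 1) = 0 := by
  have h := lcomapDomain_lmapDomain_of_ne (coneMap_injective (extRel_some_val {p | r m p})
    (rβ := extRel r Q) (extRel_vert_val m) (some_val_injective _) n)
    (g := fun _ : Unit => c) (fun _ _ e => hc (congrFun (congrArg Subtype.val e) 0).symm)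
    (Finsupp.single () 1)
  rwa [Finsupp.lmapDomain_apply, Finsupp.mapDomain_single] at h

theorem extRel_eq_some {a b : Option P} (h : extRel r Q a b) : ∃ p, b = some p := by
  match a, b with
  | _, some p => exact ⟨p, rfl⟩
  | some _, none => exact h.elim
  | none, none => exact h.elim

/-- A nonempty chain with bottom vertex `m` is a cone over a chain in `P_{>m}`. -/
theorem exists_coneMap_vert {n : ℕ} (c : OCh (Option P) (extRel r Q) (n + 1)) {m : P}
    (hc : c.1 0 = some m) :
    ∃ d : OCh {p // r m p} (fun a b => r a.1 b.1) n,
      coneMap (fun a => some a.1) (extRel_some_val {p | r m p}) (some m)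
        (extRel_vert_val m) d = c := by
  have h0 : ∀ i : Fin n, extRel r Q (c.1 0) (c.1 i.succ) := fun i => c.2 (Fin.succ_pos i)
  choose p hp using fun i => extRel_eq_some (h0 i)
  refine ⟨⟨fun i => ⟨p i, ?_⟩, fun i j hij => ?_⟩, Subtype.ext (funext fun i => ?_)⟩
  · have := h0 i
    rwa [hc, hp] at this
  · have := c.2 (Fin.succ_lt_succ_iff.2 hij)
    rwa [hp, hp] at this
  · refine Fin.cases ?_ (fun i => ?_) i
    · exact hc.symm
    · exact (hp i).symm

theorem exists_coneMap_bot {n : ℕ} (c : OCh (Option P) (extRel r Q) (n + 1))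
    (hc : c.1 0 = none) :
    ∃ d : OCh Q (fun a b => r a b) n,
      coneMap (fun a => some a.1) (extRel_some_val Q) none extRel_none_val d = c := by
  have h0 : ∀ i : Fin n, extRel r Q (c.1 0) (c.1 i.succ) := fun i => c.2 (Fin.succ_pos i)
  choose p hp using fun i => extRel_eq_some (h0 i)
  refine ⟨⟨fun i => ⟨p i, ?_⟩, fun i j hij => ?_⟩, Subtype.ext (funext fun i => ?_)⟩
  · have := h0 i
    rwa [hc, hp] at this
  · have := c.2 (Fin.succ_lt_succ_iff.2 hij)
    rwa [hp, hp] at this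
  · refine Fin.cases ?_ (fun i => ?_) i
    · exact hc.symm
    · exact (hp i).symm

theorem exists_cmap_incl (hQ : ∀ ⦃a b⦄, r a b → b ∈ Q) {n : ℕ}
    (c : OCh (Option P) (extRel r Q) (n + 1)) {q : P} (hq : q ∈ Q) (hc : c.1 0 = some q) :
    ∃ d : OCh Q (fun a b => r a b) (n + 1),
      cmap (fun a => some a.1) (extRel_some_val Q) d = c := by
  have hi : ∀ i, ∃ p ∈ Q, c.1 i = some p := by
    refine Fin.cases ⟨q, hq, hc⟩ fun i => ?_
    have h := c.2 (Fin.succ_pos i)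
    obtain ⟨p, hp⟩ := extRel_eq_some h
    rw [hc, hp] at h
    exact ⟨p, hQ h, hp⟩
  choose p hpQ hp using hi
  refine ⟨⟨fun i => ⟨p i, hpQ i⟩, fun i j hij => ?_⟩,
    Subtype.ext (funext fun i => (hp i).symm)⟩
  have := c.2 hij
  rwa [hp, hp] at this

/-- The nonempty chains of `P_Q` are the chains of `Q`, the cones from `0̂` over chains of `Q`,
and the cones from `m ∉ Q` over chains of `P_{>m}`. -/
theorem lhom_ext_extRel (hQ : ∀ ⦃a b⦄, r a b → b ∈ Q) {n : ℕ} {X : Type*} [AddCommGroup X]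
    {φ ψ : ACh (Option P) (extRel r Q) (n + 1) →ₗ[ℤ] X}
    (hincl : ∀ z, φ (inclQ r Q (n + 1) z) = ψ (inclQ r Q (n + 1) z))
    (hbot : ∀ z, φ (botL r Q n z) = ψ (botL r Q n z))
    (hvert : ∀ m ∉ Q, ∀ z, φ (vertL r Q m n z) = ψ (vertL r Q m n z)) : φ = ψ := by
  refine Finsupp.lhom_ext fun c a => ?_
  rcases hc : c.1 0 with _ | m
  · obtain ⟨d, rfl⟩ := exists_coneMap_bot c hc
    simpa only [botL, coneL_single] using hbot (Finsupp.single d a)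
  · by_cases hm : m ∈ Q
    · obtain ⟨d, rfl⟩ := exists_cmap_incl hQ c hm hc
      simpa only [inclQ, cmapL_single] using hincl (Finsupp.single d a)
    · obtain ⟨d, rfl⟩ := exists_coneMap_vert c hc
      simpa only [vertL, coneL_single] using hvert m hm (Finsupp.single d a)

/-- Regarding chains in `P_{>m}` as chains in `Q`. -/
noncomputable def gtL (hQ : ∀ ⦃a b⦄, r a b → b ∈ Q) (m : P) (n : ℕ) :
    ACh {p // r m p} (fun a b => r a.1 b.1) n →ₗ[ℤ] ACh Q (fun a b => r a b) n :=
  cmapL (rα := fun a b => r a.1 b.1) (rβ := fun a b : Q => r a b)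
    (fun a : {p // r m p} => (⟨a.1, hQ a.2⟩ : Q)) (fun _ _ h => h) n

theorem bdry_inclQ (n : ℕ) (z) :
    bdry _ _ n (inclQ r Q (n + 1) z) = inclQ r Q n (bdry _ _ n z) :=
  LinearMap.congr_fun (bdry_cmapL _ (extRel_some_val Q) n) z

theorem bdry_gtL (hQ : ∀ ⦃a b⦄, r a b → b ∈ Q) (m : P) (n : ℕ)
    (z : ACh {p // r m p} (fun a b => r a.1 b.1) (n + 1)) :
    bdry Q (fun a b => r a b) n (gtL hQ m (n + 1) z) = gtL hQ m n (bdry _ _ n z) := by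
  unfold gtL
  have h := bdry_cmapL (rα := fun a b : {p // r m p} => r a.1 b.1) (rβ := fun a b : Q => r a b)
    (fun a : {p // r m p} => (⟨a.1, hQ a.2⟩ : Q)) (fun _ _ h => h) n
  exact LinearMap.congr_fun h z

theorem bdry_botL_zero (z) : bdry _ _ 0 (botL r Q 0 z) = inclQ r Q 0 z :=
  bdry_coneL_zero _ _ _ _ z

theorem bdry_botL_succ (n : ℕ) (z) : bdry _ _ (n + 1) (botL r Q (n + 1) z) =
    inclQ r Q (n + 1) z - botL r Q n (bdry _ _ n z) :=
  bdry_coneL_succ _ _ _ _ n z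

theorem bdry_vertL_zero (hQ : ∀ ⦃a b⦄, r a b → b ∈ Q) (m : P) (z) :
    bdry _ _ 0 (vertL r Q m 0 z) = inclQ r Q 0 (gtL hQ m 0 z) :=
  (bdry_coneL_zero _ _ _ _ z).trans
    (cmapL_comp (rβ := fun a b : Q => r a b)
      (fun a : {p // r m p} => (⟨a.1, hQ a.2⟩ : Q)) (fun _ _ h => h) _ (extRel_some_val Q)
      (fun _ _ h => h) 0 z)

theorem bdry_vertL_succ (hQ : ∀ ⦃a b⦄, r a b → b ∈ Q) (m : P) (n : ℕ) (z) :
    bdry _ _ (n + 1) (vertL r Q m (n + 1) z) =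
      inclQ r Q (n + 1) (gtL hQ m (n + 1) z) - vertL r Q m n (bdry _ _ n z) :=
  (bdry_coneL_succ _ _ _ _ n z).trans (congrArg (· - _)
    (cmapL_comp (rβ := fun a b : Q => r a b)
      (fun a : {p // r m p} => (⟨a.1, hQ a.2⟩ : Q)) (fun _ _ h => h) _ (extRel_some_val Q)
      (fun _ _ h => h) (n + 1) z))

/-- The suspension `z ↦ m * z - 0̂ * z` of chains in `P_{>m}`. -/
noncomputable def suspL (hQ : ∀ ⦃a b⦄, r a b → b ∈ Q) (m : P) (n : ℕ) :
    ACh {p // r m p} (fun a b => r a.1 b.1) n →ₗ[ℤ] ACh (Option P) (extRel r Q) (n + 1) :=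
  vertL r Q m n - botL r Q n ∘ₗ gtL hQ m n

theorem suspL_apply (hQ : ∀ ⦃a b⦄, r a b → b ∈ Q) (m : P) (n : ℕ) (z) :
    suspL hQ m n z = vertL r Q m n z - botL r Q n (gtL hQ m n z) := rfl

theorem bdry_suspL_zero (hQ : ∀ ⦃a b⦄, r a b → b ∈ Q) (m : P) (z) :
    bdry _ _ 0 (suspL hQ m 0 z) = 0 := by
  rw [suspL_apply, map_sub, bdry_vertL_zero hQ, bdry_botL_zero, sub_self]

theorem bdry_suspL_succ (hQ : ∀ ⦃a b⦄, r a b → b ∈ Q) (m : P) (n : ℕ) (z) :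
    bdry _ _ (n + 1) (suspL hQ m (n + 1) z) = -suspL hQ m n (bdry _ _ n z) := by
  rw [suspL_apply, suspL_apply, map_sub, bdry_vertL_succ hQ, bdry_botL_succ, bdry_gtL]
  abel

theorem resL_suspL_self (hQ : ∀ ⦃a b⦄, r a b → b ∈ Q) (m : P) (n : ℕ) (z) :
    resL r Q m n (suspL hQ m n z) = z := by
  rw [suspL_apply, map_sub, resL_vertL_self, resL_botL, sub_zero]

theorem resL_suspL_of_ne (hQ : ∀ ⦃a b⦄, r a b → b ∈ Q) {m m' : P} (h : m ≠ m') (n : ℕ) (z) :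
    resL r Q m n (suspL hQ m' n z) = 0 := by
  rw [suspL_apply, map_sub, resL_vertL_of_ne h, resL_botL, sub_zero]

theorem resL_bdry (hQ : ∀ ⦃a b⦄, r a b → b ∈ Q) {m : P} (hm : m ∉ Q) (n : ℕ) (z) :
    resL r Q m n (bdry _ _ (n + 1) z) = -bdry _ _ n (resL r Q m (n + 1) z) := by
  have h : resL r Q m n ∘ₗ bdry _ _ (n + 1) = -(bdry _ _ n ∘ₗ resL r Q m (n + 1)) := by
    refine lhom_ext_extRel hQ (fun z => ?_) (fun z => ?_) (fun m' _ z => ?_)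
    · simp only [LinearMap.comp_apply, LinearMap.neg_apply, bdry_inclQ, resL_inclQ hm, map_zero,
        neg_zero]
    · simp only [LinearMap.comp_apply, LinearMap.neg_apply, bdry_botL_succ, map_sub,
        resL_inclQ hm, resL_botL, map_zero, neg_zero, sub_zero]
    · simp only [LinearMap.comp_apply, LinearMap.neg_apply, bdry_vertL_succ hQ, map_sub,
        resL_inclQ hm, zero_sub]
      by_cases hmm : m = m'
      · subst hmm
        rw [resL_vertL_self, resL_vertL_self]
      · rw [resL_vertL_of_ne hmm, resL_vertL_of_ne hmm, map_zero]
  exact LinearMap.congr_fun h z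

/-- The subcomplex `Q ∪ {0̂}` is contracted to `0̂`, leaving the suspensions of the `P_{>m}`. -/
theorem eq_homotopy_add_sum_suspL (hQ : ∀ ⦃a b⦄, r a b → b ∈ Q) {M : Set P} [Fintype M]
    (hM : ∀ p, p ∈ M ↔ p ∉ Q) (n : ℕ) (z : ACh (Option P) (extRel r Q) (n + 1)) :
    z = bdry _ _ (n + 1) (botL r Q (n + 1) (projQ r Q (n + 1) z)) +
      botL r Q n (projQ r Q n (bdry _ _ n z)) +
      ∑ m : M, suspL hQ m.1 n (resL r Q m.1 n z) := by
  classical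
  have h : LinearMap.id = bdry _ _ (n + 1) ∘ₗ botL r Q (n + 1) ∘ₗ projQ r Q (n + 1) +
      botL r Q n ∘ₗ projQ r Q n ∘ₗ bdry _ _ n +
      ∑ m : M, suspL hQ m.1 n ∘ₗ resL r Q m.1 n := by
    have hM' : ∀ m : M, m.1 ∉ Q := fun m => (hM _).1 m.2
    refine lhom_ext_extRel hQ (fun z => ?_) (fun z => ?_) (fun m' hm' z => ?_)
    · simp only [LinearMap.id_apply, LinearMap.add_apply, LinearMap.comp_apply,
        LinearMap.sum_apply, projQ_inclQ, bdry_inclQ, bdry_botL_succ, resL_inclQ (hM' _),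
        map_zero, Finset.sum_const_zero]
      abel
    · simp only [LinearMap.id_apply, LinearMap.add_apply, LinearMap.comp_apply,
        LinearMap.sum_apply, projQ_botL, resL_botL, map_zero, Finset.sum_const_zero]
      cases n with
      | zero => simp only [bdry_botL_zero, projQ_inclQ, zero_add, add_zero]
      | succ n => simp only [bdry_botL_succ, map_sub, projQ_inclQ, projQ_botL, zero_add,
          add_zero, sub_zero]
    · have hs : ∑ m : M, suspL hQ m.1 n (resL r Q m.1 n (vertL r Q m' n z)) =
          vertL r Q m' n z - botL r Q n (gtL hQ m' n z) := by
        rw [Finset.sum_eq_single ⟨m', (hM m').2 hm'⟩]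
        · rw [resL_vertL_self, suspL_apply]
        · intro b _ hb
          rw [resL_vertL_of_ne (fun h => hb (Subtype.ext h)), map_zero]
        · simp
      simp only [LinearMap.id_apply, LinearMap.add_apply, LinearMap.comp_apply,
        LinearMap.sum_apply, hs, projQ_vertL hm', map_zero]
      cases n with
      | zero => simp only [bdry_vertL_zero hQ, projQ_inclQ]; abel
      | succ n =>
        simp only [bdry_vertL_succ hQ, map_sub, projQ_inclQ, projQ_vertL hm', map_zero]
        abel
  simpa only [LinearMap.id_apply, LinearMap.add_apply, LinearMap.comp_apply,
    LinearMap.sum_apply] using LinearMap.congr_fun h z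

/-- Naturality of residues. -/
theorem resL_cmapL {m m' : P} (τ : Option P → Option P)
    (hτ : ∀ ⦃a b⦄, extRel r Q a b → extRel r Q (τ a) (τ b))
    (hτm : ∀ a, τ a = some m' ↔ a = some m)
    (φ : {p // r m p} → {p // r m' p}) (hφ : ∀ ⦃a b⦄, r a.1 b.1 → r (φ a).1 (φ b).1)
    (hτφ : ∀ p, τ (some p.1) = some (φ p).1) (n : ℕ) (z) :
    resL r Q m' n (cmapL τ hτ (n + 1) z) =
      cmapL (rα := fun a b => r a.1 b.1) (rβ := fun a b => r a.1 b.1) φ hφ n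
        (resL r Q m n z) := by
  have h : resL r Q m' n ∘ₗ cmapL τ hτ (n + 1) =
      cmapL (rα := fun a b => r a.1 b.1) (rβ := fun a b => r a.1 b.1) φ hφ n ∘ₗ
        resL r Q m n := by
    refine Finsupp.lhom_ext' fun c => LinearMap.ext_ring ?_
    simp only [LinearMap.comp_apply, Finsupp.lsingle_apply, cmapL_single]
    by_cases hc : c.1 0 = some m
    · obtain ⟨d, rfl⟩ := exists_coneMap_vert c hc
      have h1 := resL_vertL_self (r := r) (Q := Q) m n (Finsupp.single d 1)
      have h2 := resL_vertL_self (r := r) (Q := Q) m' n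
        (Finsupp.single (cmap (rβ := fun a b => r a.1 b.1) φ hφ d) 1)
      rw [vertL, coneL_single] at h1 h2
      rw [h1, cmapL_single, ← h2]
      congr 2
      refine Subtype.ext (funext fun i => ?_)
      refine Fin.cases ?_ (fun i => ?_) i
      · exact (hτm _).2 rfl
      · exact hτφ _
    · rw [resL_single_of_ne m c hc, resL_single_of_ne, map_zero]
      exact fun h => hc ((hτm _).1 h)
  exact LinearMap.congr_fun h z

/-- The homology of `P_Q` in positive degrees, when all elements outside `Q` are minimal. -/
theorem exists_redH_extRel_equiv (hQ : ∀ ⦃a b⦄, r a b → b ∈ Q) {M : Set P} [Fintype M]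
    (hM : ∀ p, p ∈ M ↔ p ∉ Q) (k : ℕ) :
    ∃ e : redH (Option P) (extRel r Q) (k + 1) ≃+
        ∀ m : M, redH {p // r m.1 p} (fun a b => r a.1 b.1) k,
      ∀ (z : cyc (Option P) (extRel r Q) (k + 1)) (m : M),
        ∃ y : cyc {p // r m.1 p} (fun a b => r a.1 b.1) k,
          y.1 = resL r Q m.1 (k + 1) z ∧
          e (Submodule.Quotient.mk z) m = Submodule.Quotient.mk y := by
  classical
  have hM' : ∀ m : M, m.1 ∉ Q := fun m => (hM _).1 m.2
  obtain ⟨e, he⟩ := exists_quotient_equiv_pi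
    (cyc (Option P) (extRel r Q) (k + 1)) (bdries _ _ (k + 1))
    (fun m : M => cyc {p // r m.1 p} (fun a b => r a.1 b.1) k) (fun m => bdries _ _ k)
    (fun m => resL r Q m.1 (k + 1)) (fun m => suspL hQ m.1 (k + 1))
    (fun m z hz => by
      have hz' : bdry _ _ (k + 1) z = 0 := hz
      change bdry _ _ k _ = 0
      rw [← neg_eq_zero, ← resL_bdry hQ (hM' m), hz', map_zero])
    (by
      rintro m _ ⟨w, rfl⟩
      exact ⟨-resL r Q m.1 (k + 2) w, by rw [resL_bdry hQ (hM' m), map_neg]⟩)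
    (fun m z hz => by
      have hz' : bdry _ _ k z = 0 := hz
      change bdry _ _ (k + 1) _ = 0
      rw [bdry_suspL_succ, hz', map_zero, neg_zero])
    (by
      rintro m _ ⟨w, rfl⟩
      exact ⟨-suspL hQ m.1 (k + 2) w, by rw [map_neg, bdry_suspL_succ, neg_neg]⟩)
    (fun m z => resL_suspL_self hQ _ _ z)
    (fun m m' z h => resL_suspL_of_ne hQ (fun h' => h (Subtype.ext h')) _ z)
    (fun z hz => by
      have hz' : bdry _ _ (k + 1) z = 0 := hz
      have h := eq_homotopy_add_sum_suspL hQ hM (k + 1) z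
      rw [hz', map_zero, map_zero, add_zero] at h
      exact ⟨_, (sub_eq_of_eq_add h).symm⟩)
  exact ⟨e, fun z m => ⟨_, rfl, he z m⟩⟩

/-- The homology of `P_Q` in degree zero, when all elements outside `Q` are minimal. -/
theorem exists_redH_zero_extRel_equiv (hQ : ∀ ⦃a b⦄, r a b → b ∈ Q) {M : Set P} [Fintype M]
    (hM : ∀ p, p ∈ M ↔ p ∉ Q) :
    ∃ e : redH (Option P) (extRel r Q) 0 ≃+
        ∀ m : M, redHneg {p // r m.1 p} (fun a b => r a.1 b.1),
      ∀ (z : cyc (Option P) (extRel r Q) 0) (m : M),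
        ∃ y : (⊤ : Submodule ℤ (ACh {p // r m.1 p} (fun a b => r a.1 b.1) 0)),
          y.1 = resL r Q m.1 0 z ∧
          e (Submodule.Quotient.mk z) m = Submodule.Quotient.mk y := by
  classical
  have hM' : ∀ m : M, m.1 ∉ Q := fun m => (hM _).1 m.2
  obtain ⟨e, he⟩ := exists_quotient_equiv_pi
    (cyc (Option P) (extRel r Q) 0) (bdries _ _ 0)
    (fun m : M => (⊤ : Submodule ℤ (ACh {p // r m.1 p} (fun a b => r a.1 b.1) 0)))
    (fun m => LinearMap.range (bdry _ _ 0))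
    (fun m => resL r Q m.1 0) (fun m => suspL hQ m.1 0)
    (fun m z hz => Submodule.mem_top)
    (by
      rintro m _ ⟨w, rfl⟩
      exact ⟨-resL r Q m.1 1 w, by rw [resL_bdry hQ (hM' m), map_neg]⟩)
    (fun m z _ => bdry_suspL_zero hQ _ z)
    (by
      rintro m _ ⟨w, rfl⟩
      exact ⟨-suspL hQ m.1 1 w, by rw [map_neg, bdry_suspL_succ, neg_neg]⟩)
    (fun m z => resL_suspL_self hQ _ _ z)
    (fun m m' z h => resL_suspL_of_ne hQ (fun h' => h (Subtype.ext h')) _ z)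
    (fun z hz => by
      have hz' : bdry _ _ 0 z = 0 := hz
      have h := eq_homotopy_add_sum_suspL hQ hM 0 z
      rw [hz', map_zero, map_zero, add_zero] at h
      exact ⟨_, (sub_eq_of_eq_add h).symm⟩)
  exact ⟨e, fun z m => ⟨_, rfl, he z m⟩⟩

end MinimalVertices

section Induction

/-- If `G` permutes the summands of a direct sum through `A`, the component of the translate. -/
theorem toAddMonoid_of_smul_apply {G M : Type*} [Group G] [MulAction G M] [DecidableEq M]
    {H : M → Type*} [∀ m, AddCommGroup (H m)] (g : G) (A : ∀ m, H m →+ H (g • m))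
    (x : ⨁ m, H m) (m : M) :
    (DirectSum.toAddMonoid (fun m => (DirectSum.of H (g • m)).comp (A m)) x) (g • m) =
      A m (x m) := by
  induction x using DirectSum.induction_on with
  | zero => simp
  | add x y hx hy => simp only [map_add, DirectSum.add_apply, hx, hy]
  | of m' y =>
    rw [DirectSum.toAddMonoid_of, AddMonoidHom.comp_apply]
    by_cases h : m' = m
    · subst h
      rw [DirectSum.of_eq_same, DirectSum.of_eq_same]
    · rw [DirectSum.of_eq_of_ne _ _ _ (fun h' => h (MulAction.injective g h'.symm)),
        DirectSum.of_eq_of_ne _ _ _ (Ne.symm h), map_zero]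

/-- Replacing a finite product permuted by `G` by the corresponding direct sum. -/
theorem exists_directSum_equiv_of_pi {G M : Type*} [Group G] [MulAction G M] [DecidableEq M]
    [Finite M] {H : M → Type*} [∀ m, AddCommGroup (H m)] {X : Type*} [AddCommGroup X]
    (e : X ≃+ ∀ m, H m) (T : G → X → X) (A : ∀ (g : G) m, H m →+ H (g • m))
    (he : ∀ g x m, e (T g x) (g • m) = A g m (e x m)) :
    ∃ e' : X ≃+ ⨁ m, H m, ∀ g x, e' (T g x) =
      DirectSum.toAddMonoid (fun m => (DirectSum.of H (g • m)).comp (A g m)) (e' x) := by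
  have : Fintype M := Fintype.ofFinite M
  let E := DirectSum.addEquivProd H
  have hE : ∀ y m, ((e.trans E.symm) y) m = e y m := fun y m =>
    congrFun (E.apply_symm_apply (e y)) m
  refine ⟨e.trans E.symm, fun g x => DFinsupp.ext fun m' => ?_⟩
  obtain ⟨m, rfl⟩ := MulAction.surjective g m'
  refine (hE _ _).trans (Eq.trans ?_ (toAddMonoid_of_smul_apply g (A g) _ m).symm)
  rw [hE, he]

/-- A direct sum whose summands are permuted by `G` is the direct sum over the orbits of the
modules induced from the stabilisers. -/
theorem exists_directSum_equiv_induced {G M : Type*} [Group G] [MulAction G M] [DecidableEq M]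
    [Finite M] {H : M → Type*} [∀ m, AddCommGroup (H m)]
    (B : ∀ (g : G) (m m' : M), g • m = m' → (H m →+ H m'))
    (hone : ∀ m h x, B 1 m m h x = x)
    (hmul : ∀ g g' m m' m'' h h' h'' x,
      B (g' * g) m m'' h'' x = B g' m' m'' h' (B g m m' h x))
    (reps : Set M) [DecidableEq reps] (hreps : ∀ m : M, ∃! m₀, m₀ ∈ reps ∧ ∃ g : G, g • m = m₀)
    (stab : M → Set G) (hstab : ∀ m h, h ∈ stab m ↔ h • m = m)
    (ρ : ∀ m h, h ∈ stab m → (H m →+ H m))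
    (hρ : ∀ m h hh hm x, ρ m h hh x = B h m m hm x)
    (A : ∀ (g : G) m, H m →+ H (g • m)) (hA : ∀ g m x, A g m x = B g m (g • m) rfl x) :
    ∃ e : (⨁ m, H m) ≃+ ⨁ m₀ : reps, IndSubG (stab m₀.1) (ρ m₀.1),
      ∀ (g : G) (x : ⨁ m, H m),
        e (DirectSum.toAddMonoid (fun m => (DirectSum.of H (g • m)).comp (A g m)) x) =
          DirectSum.toAddMonoid (fun m₀ : reps =>
            (DirectSum.of (fun m₀ : reps => IndSubG (stab m₀.1) (ρ m₀.1)) m₀).comp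
              (indTrans (stab m₀.1) (ρ m₀.1) g)) (e x) := by
  have : Fintype reps := Fintype.ofFinite _
  have : Fintype M := Fintype.ofFinite _
  let E : (∀ m₀ : reps, IndSubG (stab m₀.1) (ρ m₀.1)) ≃+ _ :=
    (DirectSum.addEquivProd fun m₀ : reps => IndSubG (stab m₀.1) (ρ m₀.1)).symm
  let F : (⨁ m, H m) →+ ∀ m₀ : reps, IndSubG (stab m₀.1) (ρ m₀.1) :=
    { toFun := fun x m₀ => ⟨fun g => B g⁻¹ (g • m₀.1) m₀.1 (inv_smul_smul _ _) (x (g • m₀.1)), by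
        intro g h hh hh'
        have hm := (hstab _ _).1 hh
        have hm' := (hstab _ _).1 hh'
        rw [hρ _ _ _ hm', ← hmul g⁻¹ h⁻¹ _ _ _ _ _
          (by rw [← mul_inv_rev, inv_smul_eq_iff, mul_smul, hm])]
        have key : ∀ (a : M) (b : G) (h1 : g • m₀.1 = a) (h2 : b • a = m₀.1) (h3 : _),
            B b a m₀.1 h2 (x a) = B b (g • m₀.1) m₀.1 h3 (x (g • m₀.1)) := by
          rintro a b rfl h2 h3
          rfl
        have h4 := key ((g * h) • m₀.1) (g * h)⁻¹ (by rw [mul_smul, hm]) (inv_smul_smul _ _)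
          (by rw [inv_smul_eq_iff, mul_smul, hm])
        refine h4.trans ?_
        congr 2
        exact mul_inv_rev g h⟩
      map_zero' := by
        funext m₀
        refine Subtype.ext (funext fun g => ?_)
        simp
      map_add' := fun x y => by
        funext m₀
        refine Subtype.ext (funext fun g => ?_)
        simp }
  have hF : ∀ x m₀ g, (F x m₀).1 g =
      B g⁻¹ (g • m₀.1) m₀.1 (inv_smul_smul _ _) (x (g • m₀.1)) := fun _ _ _ => rfl
  have hinj : Function.Injective F := by
    refine (injective_iff_map_eq_zero _).2 fun x hx => ?_
    refine DFinsupp.ext fun m => ?_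
    obtain ⟨m₀, ⟨hm₀, g, hg⟩, -⟩ := hreps m
    have hg' : g⁻¹ • m₀ = m := inv_smul_eq_iff.2 hg.symm
    subst hg'
    have h := hF x ⟨m₀, hm₀⟩ g⁻¹
    rw [hx] at h
    have h2 := hmul (g⁻¹)⁻¹ g⁻¹ (g⁻¹ • m₀) m₀ (g⁻¹ • m₀) (inv_smul_smul _ _) rfl
      (by rw [mul_inv_cancel, one_smul]) (x (g⁻¹ • m₀))
    rw [← h] at h2
    have h3 : ∀ (b : G) (_ : b = 1) (hb : b • g⁻¹ • m₀ = g⁻¹ • m₀),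
        B b _ _ hb (x (g⁻¹ • m₀)) = x (g⁻¹ • m₀) := by
      rintro b rfl hb
      exact hone _ _ _
    rw [h3 _ (mul_inv_cancel _)] at h2
    exact h2.trans (map_zero _)
  have hsurj : Function.Surjective F := by
    intro f
    have hv : ∀ m : M, ∃ v : H m, ∀ (m₀ : reps) (g : G) (hg : g • m₀.1 = m),
        v = B g m₀.1 m hg ((f m₀).1 g) := by
      intro m
      obtain ⟨m₀, ⟨hm₀, g, hg⟩, huniq⟩ := hreps m
      have hg₀ : g⁻¹ • m₀ = m := inv_smul_eq_iff.2 hg.symm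
      refine ⟨B g⁻¹ m₀ m hg₀ ((f ⟨m₀, hm₀⟩).1 g⁻¹), ?_⟩
      rintro ⟨m₁, hm₁⟩ g' hg'
      obtain rfl : m₁ = m₀ := huniq m₁ ⟨hm₁, g'⁻¹, inv_smul_eq_iff.2 hg'.symm⟩
      have hh : (g * g') • m₁ = m₁ := by rw [mul_smul, hg', hg]
      have hh' : (g * g')⁻¹ • m₁ = m₁ := inv_smul_eq_iff.2 hh.symm
      have h := (f ⟨m₁, hm₁⟩).2 g⁻¹ (g * g') ((hstab _ _).2 hh) ((hstab _ _).2 hh')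
      rw [inv_mul_cancel_left, hρ _ _ _ hh'] at h
      refine Eq.trans ?_ (congrArg _ h.symm)
      rw [← hmul (g * g')⁻¹ g' m₁ m₁ m hh' hg'
        (by rw [mul_inv_rev, mul_inv_cancel_left]; exact hg₀)]
      congr 2
      rw [mul_inv_rev, mul_inv_cancel_left]
    choose v hv using hv
    refine ⟨(DirectSum.addEquivProd H).symm v, ?_⟩
    funext m₀
    refine Subtype.ext (funext fun g => ?_)
    rw [hF]
    have h1 : (DirectSum.addEquivProd H).symm v (g • m₀.1) = v (g • m₀.1) :=
      congrFun ((DirectSum.addEquivProd H).apply_symm_apply v) _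
    rw [h1, hv (g • m₀.1) m₀ g rfl, ← hmul g g⁻¹ _ _ _ _ _ (by rw [inv_mul_cancel, one_smul])]
    have h3 : ∀ (b : G) (_ : b = 1) (hb : b • m₀.1 = m₀.1) (y : H m₀.1), B b _ _ hb y = y := by
      rintro b rfl hb y
      exact hone _ _ _
    exact h3 _ (inv_mul_cancel _) _ _
  refine ⟨(AddEquiv.ofBijective F ⟨hinj, hsurj⟩).trans E, fun g x => ?_⟩
  refine (DirectSum.addEquivProd _).injective (funext fun m₀ => ?_)
  refine (congrFun (E.symm_apply_apply _) m₀).trans ?_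
  have hR : ∀ y : ⨁ m₀ : reps, IndSubG (stab m₀.1) (ρ m₀.1),
      (DirectSum.toAddMonoid (fun m₀ : reps =>
            (DirectSum.of (fun m₀ : reps => IndSubG (stab m₀.1) (ρ m₀.1)) m₀).comp
              (indTrans (stab m₀.1) (ρ m₀.1) g)) y) m₀ =
        indTrans (stab m₀.1) (ρ m₀.1) g (y m₀) := by
    intro y
    induction y using DirectSum.induction_on with
    | zero => simp
    | add x y hx hy => simp only [map_add, DirectSum.add_apply, hx, hy]
    | of m' y =>
      rw [DirectSum.toAddMonoid_of, AddMonoidHom.comp_apply]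
      by_cases h : m' = m₀
      · subst h
        rw [DirectSum.of_eq_same, DirectSum.of_eq_same]
      · rw [DirectSum.of_eq_of_ne _ _ _ (Ne.symm h), DirectSum.of_eq_of_ne _ _ _ (Ne.symm h),
          map_zero]
  refine Eq.trans ?_ (hR _).symm
  have hE : (((AddEquiv.ofBijective F ⟨hinj, hsurj⟩).trans E) x) m₀ = F x m₀ :=
    congrFun (E.symm_apply_apply (F x)) m₀
  rw [hE]
  refine Subtype.ext (funext fun a => ?_)
  change (F _ m₀).1 a = (F x m₀).1 (g⁻¹ * a)
  rw [hF, hF]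
  have key : ∀ (b : M) (c : G) (hb : g • (g⁻¹ * a) • m₀.1 = b) (hc : c • b = m₀.1) (hd : _),
      B c b m₀.1 hc
        ((DirectSum.toAddMonoid (fun m => (DirectSum.of H (g • m)).comp (A g m)) x) b) =
      B (c * g) ((g⁻¹ * a) • m₀.1) m₀.1 hd (x ((g⁻¹ * a) • m₀.1)) := by
    rintro b c rfl hc hd
    rw [toAddMonoid_of_smul_apply, hA, ← hmul]
  rw [key (a • m₀.1) a⁻¹ (by rw [← mul_smul, mul_inv_cancel_left]) (inv_smul_smul _ _)
    (by rw [← mul_smul]; group; exact one_smul _ _)]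
  congr 2
  group

end Induction

section Equivariance

variable {P : Type*} {r : P → P → Prop} {Q M : Set P} {G : Type*} [Group G] [MulAction G M]

/-- The homology of `P_Q` in positive degrees as a `G`-module. -/
theorem exists_redH_extRel_directSum_equiv (hQ : ∀ ⦃a b⦄, r a b → b ∈ Q) [Finite M]
    [DecidableEq M] (hM : ∀ p, p ∈ M ↔ p ∉ Q) (U : Option P → Option P → Prop)
    (hU : U = extRel r Q) (τ : G → Option P → Option P)
    (hτ : ∀ g, ∀ ⦃a b⦄, U a b → U (τ g a) (τ g b))
    (hτm : ∀ g (m : M) a, τ g a = some (g • m).1 ↔ a = some m.1)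
    (φ : ∀ (g : G) (m : M), {p // r m.1 p} → {p // r (g • m).1 p})
    (hφ : ∀ g m, ∀ ⦃a b : {p // r m.1 p}⦄, r a.1 b.1 → r (φ g m a).1 (φ g m b).1)
    (hτφ : ∀ g m (p : {p // r m.1 p}), τ g (some p.1) = some (φ g m p).1) (k : ℕ) :
    ∃ e : redH (Option P) U (k + 1) ≃+
        ⨁ m : M, redH {p // r m.1 p} (fun a b => r a.1 b.1) k,
      ∀ (g : G) (x : redH (Option P) U (k + 1)),
        e (indH (τ g) (hτ g) (k + 1) x) =
          DirectSum.toAddMonoid (fun m : M =>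
            (DirectSum.of (fun m : M => redH {p // r m.1 p} (fun a b => r a.1 b.1) k)
              (g • m)).comp
              (indH (rα := fun a b : {p // r m.1 p} => r a.1 b.1)
                (rβ := fun a b : {p // r (g • m).1 p} => r a.1 b.1) (φ g m)
                (hφ g m) k).toAddMonoidHom) (e x) := by
  subst hU
  have : Fintype M := Fintype.ofFinite M
  obtain ⟨e, he⟩ := exists_redH_extRel_equiv hQ hM k
  have h : ∀ (g : G) (x : redH (Option P) (extRel r Q) (k + 1)) (m : M),
      e (indH (τ g) (hτ g) (k + 1) x) (g • m) =
        indH (rα := fun a b : {p // r m.1 p} => r a.1 b.1)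
          (rβ := fun a b : {p // r (g • m).1 p} => r a.1 b.1) (φ g m) (hφ g m) k (e x m) := by
    intro g x m
    obtain ⟨z, rfl⟩ := Submodule.Quotient.mk_surjective _ x
    obtain ⟨y, hy, hey⟩ := he z m
    obtain ⟨y', hy', hey'⟩ := he ⟨_, cmapL_mem_cyc (τ g) (hτ g) z.2⟩ (g • m)
    rw [indH_mk, hey, hey', indH_mk]
    refine congrArg _ (Subtype.ext ?_)
    have h1 := resL_cmapL (τ g) (hτ g) (hτm g m) (φ g m) (hφ g m) (hτφ g m) (k + 1) z.1
    rw [← hy] at h1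
    exact hy'.trans h1
  have h2 := exists_directSum_equiv_of_pi
    (H := fun m : M => redH {p // r m.1 p} (fun a b => r a.1 b.1) k) e
    (fun g => indH (τ g) (hτ g) (k + 1))
    (fun g m => (indH (rα := fun a b : {p // r m.1 p} => r a.1 b.1)
      (rβ := fun a b : {p // r (g • m).1 p} => r a.1 b.1) (φ g m)
      (hφ g m) k).toAddMonoidHom) h
  exact h2

/-- The homology of `P_Q` in degree zero as a `G`-module. -/
theorem exists_redH_zero_extRel_directSum_equiv (hQ : ∀ ⦃a b⦄, r a b → b ∈ Q) [Finite M]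
    [DecidableEq M] (hM : ∀ p, p ∈ M ↔ p ∉ Q) (U : Option P → Option P → Prop)
    (hU : U = extRel r Q) (τ : G → Option P → Option P)
    (hτ : ∀ g, ∀ ⦃a b⦄, U a b → U (τ g a) (τ g b))
    (hτm : ∀ g (m : M) a, τ g a = some (g • m).1 ↔ a = some m.1)
    (φ : ∀ (g : G) (m : M), {p // r m.1 p} → {p // r (g • m).1 p})
    (hφ : ∀ g m, ∀ ⦃a b : {p // r m.1 p}⦄, r a.1 b.1 → r (φ g m a).1 (φ g m b).1)
    (hτφ : ∀ g m (p : {p // r m.1 p}), τ g (some p.1) = some (φ g m p).1) :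
    ∃ e : redH (Option P) U 0 ≃+
        ⨁ m : M, redHneg {p // r m.1 p} (fun a b => r a.1 b.1),
      ∀ (g : G) (x : redH (Option P) U 0),
        e (indH (τ g) (hτ g) 0 x) =
          DirectSum.toAddMonoid (fun m : M =>
            (DirectSum.of (fun m : M => redHneg {p // r m.1 p} (fun a b => r a.1 b.1))
              (g • m)).comp
              (indHneg (rα := fun a b : {p // r m.1 p} => r a.1 b.1)
                (rβ := fun a b : {p // r (g • m).1 p} => r a.1 b.1) (φ g m)
                (hφ g m)).toAddMonoidHom) (e x) := by
  subst hU
  have : Fintype M := Fintype.ofFinite M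
  obtain ⟨e, he⟩ := exists_redH_zero_extRel_equiv hQ hM
  have h : ∀ (g : G) (x : redH (Option P) (extRel r Q) 0) (m : M),
      e (indH (τ g) (hτ g) 0 x) (g • m) =
        indHneg (rα := fun a b : {p // r m.1 p} => r a.1 b.1)
          (rβ := fun a b : {p // r (g • m).1 p} => r a.1 b.1) (φ g m) (hφ g m) (e x m) := by
    intro g x m
    obtain ⟨z, rfl⟩ := Submodule.Quotient.mk_surjective _ x
    obtain ⟨y, hy, hey⟩ := he z m
    obtain ⟨y', hy', hey'⟩ := he ⟨_, cmapL_mem_cyc (τ g) (hτ g) z.2⟩ (g • m)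
    rw [indH_mk, hey, hey', indHneg_mk]
    refine congrArg _ (Subtype.ext ?_)
    have h1 := resL_cmapL (τ g) (hτ g) (hτm g m) (φ g m) (hφ g m) (hτφ g m) 0 z.1
    rw [← hy] at h1
    exact hy'.trans h1
  have h2 := exists_directSum_equiv_of_pi
    (H := fun m : M => redHneg {p // r m.1 p} (fun a b => r a.1 b.1)) e
    (fun g => indH (τ g) (hτ g) 0)
    (fun g m => (indHneg (rα := fun a b : {p // r m.1 p} => r a.1 b.1)
      (rβ := fun a b : {p // r (g • m).1 p} => r a.1 b.1) (φ g m)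
      (hφ g m)).toAddMonoidHom) h
  exact h2

end Equivariance

section InducedModules

variable {P : Type*} {r : P → P → Prop} {M : Set P} {G : Type*} [Group G] [MulAction G P]
  [MulAction G M]

/-- Translation by `g` as a map from `P_{>m}` to `P_{>gm}`. -/
def gtMap (hr : ∀ (g : G) ⦃a b : P⦄, r a b → r (g • a) (g • b)) {g : G} {m m' : P}
    (h : g • m = m') (p : {p // r m p}) : {p // r m' p} :=
  ⟨g • p.1, h ▸ hr g p.2⟩

/-- The direct sum of the homologies of the `P_{>m}` as a sum of induced modules. -/
theorem exists_directSum_redH_equiv_induced [Finite M] [DecidableEq M]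
    (hM : ∀ (g : G) (m : M), (g • m).1 = g • m.1)
    (hr : ∀ (g : G) ⦃a b : P⦄, r a b → r (g • a) (g • b))
    (φ : ∀ (g : G) (m : M), {p // r m.1 p} → {p // r (g • m).1 p})
    (hφ : ∀ g m, ∀ ⦃a b : {p // r m.1 p}⦄, r a.1 b.1 → r (φ g m a).1 (φ g m b).1)
    (hφv : ∀ g m p, (φ g m p).1 = g • p.1)
    (reps : Set M) [DecidableEq reps] (hreps : ∀ m : M, ∃! m₀, m₀ ∈ reps ∧ ∃ g : G, g • m = m₀)
    (stab : M → Set G) (hstab : ∀ m h, h ∈ stab m ↔ h • m = m)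
    (ψ : ∀ m h, h ∈ stab m → {p // r m.1 p} → {p // r m.1 p})
    (hψ : ∀ m h hh, ∀ ⦃a b : {p // r m.1 p}⦄, r a.1 b.1 → r (ψ m h hh a).1 (ψ m h hh b).1)
    (hψv : ∀ m h hh p, (ψ m h hh p).1 = h • p.1) (k : ℕ) :
    ∃ e : (⨁ m : M, redH {p // r m.1 p} (fun a b => r a.1 b.1) k) ≃+
        ⨁ m₀ : reps, IndSubG (stab m₀.1) (fun h hh =>
          (indH (rα := fun a b : {p // r m₀.1.1 p} => r a.1 b.1)
            (rβ := fun a b : {p // r m₀.1.1 p} => r a.1 b.1) (ψ m₀.1 h hh)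
            (hψ m₀.1 h hh) k).toAddMonoidHom),
      ∀ (g : G) (x : ⨁ m : M, redH {p // r m.1 p} (fun a b => r a.1 b.1) k),
        e (DirectSum.toAddMonoid (fun m : M =>
            (DirectSum.of (fun m : M => redH {p // r m.1 p} (fun a b => r a.1 b.1) k)
              (g • m)).comp
              (indH (rα := fun a b : {p // r m.1 p} => r a.1 b.1)
                (rβ := fun a b : {p // r (g • m).1 p} => r a.1 b.1) (φ g m)
                (hφ g m) k).toAddMonoidHom) x) =
          DirectSum.toAddMonoid (fun m₀ : reps =>
            (DirectSum.of (fun m₀ : reps => IndSubG (stab m₀.1) (fun h hh =>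
              (indH (rα := fun a b : {p // r m₀.1.1 p} => r a.1 b.1)
                (rβ := fun a b : {p // r m₀.1.1 p} => r a.1 b.1) (ψ m₀.1 h hh)
                (hψ m₀.1 h hh) k).toAddMonoidHom)) m₀).comp
              (indTrans (stab m₀.1) (fun h hh =>
                (indH (rα := fun a b : {p // r m₀.1.1 p} => r a.1 b.1)
                  (rβ := fun a b : {p // r m₀.1.1 p} => r a.1 b.1) (ψ m₀.1 h hh)
                  (hψ m₀.1 h hh) k).toAddMonoidHom) g)) (e x) := by
  have hgt : ∀ {g : G} {m m' : M}, g • m = m' → g • m.1 = m'.1 := fun h => h ▸ (hM _ _).symm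
  have h := exists_directSum_equiv_induced
    (H := fun m : M => redH {p // r m.1 p} (fun a b => r a.1 b.1) k)
    (B := fun g m m' h => (indH (rα := fun a b : {p // r m.1 p} => r a.1 b.1)
      (rβ := fun a b : {p // r m'.1 p} => r a.1 b.1) (gtMap hr (hgt h))
      (fun _ _ h => hr g h) k).toAddMonoidHom)
    (hone := fun m h x => ?hone)
    (hmul := fun g g' m m' m'' h h' h'' x => ?hmul)
    reps hreps stab hstab
    (ρ := fun m h hh => (indH (rα := fun a b : {p // r m.1 p} => r a.1 b.1)
      (rβ := fun a b : {p // r m.1 p} => r a.1 b.1) (ψ m h hh) (hψ m h hh) k).toAddMonoidHom)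
    (hρ := fun m h hh hm x => ?hρ)
    (A := fun g m => (indH (rα := fun a b : {p // r m.1 p} => r a.1 b.1)
      (rβ := fun a b : {p // r (g • m).1 p} => r a.1 b.1) (φ g m)
      (hφ g m) k).toAddMonoidHom)
    (hA := fun g m x => ?hA)
  case hone =>
    have e1 : gtMap hr (hgt h) = (id : {p // r m.1 p} → {p // r m.1 p}) :=
      funext fun p => Subtype.ext (one_smul G p.1)
    exact (indH_congr e1 _ (fun _ _ h => h) k x).trans (indH_id (fun _ _ h => h) k x)
  case hmul =>
    have e1 : gtMap hr (hgt h'') = gtMap hr (hgt h') ∘ gtMap hr (hgt h) :=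
      funext fun p => Subtype.ext (mul_smul g' g p.1)
    exact (indH_congr e1 _ (fun _ _ h => hr g' (hr g h)) k x).trans
      (indH_comp (rα := fun a b : {p // r m.1 p} => r a.1 b.1)
        (rβ := fun a b : {p // r m'.1 p} => r a.1 b.1)
        (rδ := fun a b : {p // r m''.1 p} => r a.1 b.1)
        (gtMap hr (hgt h)) (fun _ _ h => hr g h) (gtMap hr (hgt h'))
        (fun _ _ h => hr g' h) (fun _ _ h => hr g' (hr g h)) k x)
  case hρ =>
    exact indH_congr (funext fun p => Subtype.ext (hψv m h hh p)) _ _ k x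
  case hA =>
    exact indH_congr (funext fun p => Subtype.ext (hφv g m p)) _ _ k x
  exact h

/-- The degree `-1` analogue of `exists_directSum_redH_equiv_induced`. -/
theorem exists_directSum_redHneg_equiv_induced [Finite M] [DecidableEq M]
    (hM : ∀ (g : G) (m : M), (g • m).1 = g • m.1)
    (hr : ∀ (g : G) ⦃a b : P⦄, r a b → r (g • a) (g • b))
    (φ : ∀ (g : G) (m : M), {p // r m.1 p} → {p // r (g • m).1 p})
    (hφ : ∀ g m, ∀ ⦃a b : {p // r m.1 p}⦄, r a.1 b.1 → r (φ g m a).1 (φ g m b).1)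
    (hφv : ∀ g m p, (φ g m p).1 = g • p.1)
    (reps : Set M) [DecidableEq reps] (hreps : ∀ m : M, ∃! m₀, m₀ ∈ reps ∧ ∃ g : G, g • m = m₀)
    (stab : M → Set G) (hstab : ∀ m h, h ∈ stab m ↔ h • m = m)
    (ψ : ∀ m h, h ∈ stab m → {p // r m.1 p} → {p // r m.1 p})
    (hψ : ∀ m h hh, ∀ ⦃a b : {p // r m.1 p}⦄, r a.1 b.1 → r (ψ m h hh a).1 (ψ m h hh b).1)
    (hψv : ∀ m h hh p, (ψ m h hh p).1 = h • p.1) :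
    ∃ e : (⨁ m : M, redHneg {p // r m.1 p} (fun a b => r a.1 b.1)) ≃+
        ⨁ m₀ : reps, IndSubG (stab m₀.1) (fun h hh =>
          (indHneg (rα := fun a b : {p // r m₀.1.1 p} => r a.1 b.1)
            (rβ := fun a b : {p // r m₀.1.1 p} => r a.1 b.1) (ψ m₀.1 h hh)
            (hψ m₀.1 h hh)).toAddMonoidHom),
      ∀ (g : G) (x : ⨁ m : M, redHneg {p // r m.1 p} (fun a b => r a.1 b.1)),
        e (DirectSum.toAddMonoid (fun m : M =>
            (DirectSum.of (fun m : M => redHneg {p // r m.1 p} (fun a b => r a.1 b.1))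
              (g • m)).comp
              (indHneg (rα := fun a b : {p // r m.1 p} => r a.1 b.1)
                (rβ := fun a b : {p // r (g • m).1 p} => r a.1 b.1) (φ g m)
                (hφ g m)).toAddMonoidHom) x) =
          DirectSum.toAddMonoid (fun m₀ : reps =>
            (DirectSum.of (fun m₀ : reps => IndSubG (stab m₀.1) (fun h hh =>
              (indHneg (rα := fun a b : {p // r m₀.1.1 p} => r a.1 b.1)
                (rβ := fun a b : {p // r m₀.1.1 p} => r a.1 b.1) (ψ m₀.1 h hh)
                (hψ m₀.1 h hh)).toAddMonoidHom)) m₀).comp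
              (indTrans (stab m₀.1) (fun h hh =>
                (indHneg (rα := fun a b : {p // r m₀.1.1 p} => r a.1 b.1)
                  (rβ := fun a b : {p // r m₀.1.1 p} => r a.1 b.1) (ψ m₀.1 h hh)
                  (hψ m₀.1 h hh)).toAddMonoidHom) g)) (e x) := by
  have hgt : ∀ {g : G} {m m' : M}, g • m = m' → g • m.1 = m'.1 := fun h => h ▸ (hM _ _).symm
  have h := exists_directSum_equiv_induced
    (H := fun m : M => redHneg {p // r m.1 p} (fun a b => r a.1 b.1))
    (B := fun g m m' h => (indHneg (rα := fun a b : {p // r m.1 p} => r a.1 b.1)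
      (rβ := fun a b : {p // r m'.1 p} => r a.1 b.1) (gtMap hr (hgt h))
      (fun _ _ h => hr g h)).toAddMonoidHom)
    (hone := fun m h x => ?hone)
    (hmul := fun g g' m m' m'' h h' h'' x => ?hmul)
    reps hreps stab hstab
    (ρ := fun m h hh => (indHneg (rα := fun a b : {p // r m.1 p} => r a.1 b.1)
      (rβ := fun a b : {p // r m.1 p} => r a.1 b.1) (ψ m h hh) (hψ m h hh)).toAddMonoidHom)
    (hρ := fun m h hh hm x => ?hρ)
    (A := fun g m => (indHneg (rα := fun a b : {p // r m.1 p} => r a.1 b.1)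
      (rβ := fun a b : {p // r (g • m).1 p} => r a.1 b.1) (φ g m)
      (hφ g m)).toAddMonoidHom)
    (hA := fun g m x => ?hA)
  case hone =>
    have e1 : gtMap hr (hgt h) = (id : {p // r m.1 p} → {p // r m.1 p}) :=
      funext fun p => Subtype.ext (one_smul G p.1)
    exact (indHneg_congr e1 _ (fun _ _ h => h) x).trans (indHneg_id (fun _ _ h => h) x)
  case hmul =>
    have e1 : gtMap hr (hgt h'') = gtMap hr (hgt h') ∘ gtMap hr (hgt h) :=
      funext fun p => Subtype.ext (mul_smul g' g p.1)
    exact (indHneg_congr e1 _ (fun _ _ h => hr g' (hr g h)) x).trans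
      (indHneg_comp (rα := fun a b : {p // r m.1 p} => r a.1 b.1)
        (rβ := fun a b : {p // r m'.1 p} => r a.1 b.1)
        (rδ := fun a b : {p // r m''.1 p} => r a.1 b.1)
        (gtMap hr (hgt h)) (fun _ _ h => hr g h) (gtMap hr (hgt h'))
        (fun _ _ h => hr g' h) (fun _ _ h => hr g' (hr g h)) x)
  case hρ =>
    exact indHneg_congr (funext fun p => Subtype.ext (hψv m h hh p)) _ _ x
  case hA =>
    exact indHneg_congr (funext fun p => Subtype.ext (hφv g m p)) _ _ x
  exact h

end InducedModules

section Eigenspaces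

variable {n : ℕ} {γ : Matrix.GeneralLinearGroup (Fin n) ℂ}
  {G : Subgroup (Matrix.GeneralLinearGroup (Fin n) ℂ)} {ζ : ℂ}

theorem finite_Sp (hG : (G : Set (Matrix.GeneralLinearGroup (Fin n) ℂ)).Finite) :
    (Sp γ G ζ).Finite := by
  refine (hG.image fun g => eigSp (γ * g) ζ).subset ?_
  rintro E ⟨⟨g, hg, rfl⟩, -⟩
  exact ⟨g, hg, rfl⟩

theorem map_matOf_one (E : Submodule ℂ (Fin n → ℂ)) :
    Submodule.map (Matrix.toLin' (matOf (1 : G))) E = E := by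
  simp [matOf]

theorem map_matOf_mul (g h : G) (E : Submodule ℂ (Fin n → ℂ)) :
    Submodule.map (Matrix.toLin' (matOf (g * h))) E =
      Submodule.map (Matrix.toLin' (matOf g)) (Submodule.map (Matrix.toLin' (matOf h)) E) := by
  rw [← Submodule.map_comp, ← Matrix.toLin'_mul]
  simp [matOf]

theorem map_matOf_injective (g : G) :
    Function.Injective (Submodule.map (Matrix.toLin' (matOf g))) := by
  refine Function.LeftInverse.injective (g := Submodule.map (Matrix.toLin' (matOf g⁻¹)))
    fun E => ?_
  rw [← map_matOf_mul, inv_mul_cancel, map_matOf_one]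

theorem Urel_eq_extRel :
    Urel γ G ζ = extRel (rSp γ G ζ) {E | E.1 ∈ Tp γ G ζ} := by
  funext a b
  cases a <;> cases b <;> rfl

theorem rSp_mem_Tp ⦃E F : Sp γ G ζ⦄ (h : rSp γ G ζ E F) : F ∈ {E : Sp γ G ζ | E.1 ∈ Tp γ G ζ} :=
  ⟨F.2, E.1, E.2, h⟩

theorem mem_MpSub_iff (E : Sp γ G ζ) :
    E ∈ MpSub γ G ζ ↔ E ∉ {E : Sp γ G ζ | E.1 ∈ Tp γ G ζ} :=
  ⟨fun h ⟨_, F, hF, hlt⟩ => h.2 F hF hlt,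
    fun h => ⟨E.2, fun F hF hlt => h ⟨E.2, F, hF, hlt⟩⟩⟩

end Eigenspaces

/-- Theorem 4.2(iii).  For a unitary reflection coset `γG` in `V = ℂⁿ`,
a root of unity `ζ` and `M` the set of maximal eigenspaces: for every `n ≥ 0`,
`H̃ₙ(U'_ζᵛ(γG)) ≅_G ⊕_{m ∈ M} H̃ₙ₋₁((S'_ζᵛ(γG))_{>m}) ≅_G ⊕_{m ∈ [G\M]} Ind_{G_m}^G
H̃ₙ₋₁((S'_ζᵛ(γG))_{>m})`.  The case `n = k + 1` is covered by `e1`/`e2` below and the case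
`n = 0` (where `H̃₋₁` appears) by `e0`/`e0'`.  The `G`-actions are realized by any
order-preserving maps with the stated values, and `Ind` is modelled by equivariant
functions `G → H̃ₙ₋₁((S')_{>m})`. -/
theorem statement16 {n : ℕ} (γ : Matrix.GeneralLinearGroup (Fin n) ℂ)
    (G : Subgroup (Matrix.GeneralLinearGroup (Fin n) ℂ))
    (hG : IsUnitaryReflectionGroup G) (hγ : Normalises γ G)
    (ζ : ℂ) (hζ : ∃ m : ℕ, 0 < m ∧ ζ ^ m = 1)
    (σU : ↥G → Option ↥(Sp γ G ζ) → Option ↥(Sp γ G ζ))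
    (hσUnone : ∀ g, σU g none = none)
    (hσUval : ∀ (g : ↥G) (E : ↥(Sp γ G ζ)), ∃ F : ↥(Sp γ G ζ),
      σU g (some E) = some F ∧
        (F : Submodule ℂ (Fin n → ℂ)) =
          Submodule.map (Matrix.toLin' (matOf g)) (E : Submodule ℂ (Fin n → ℂ)))
    (hσUmono : ∀ g : ↥G, ∀ ⦃x y⦄, Urel γ G ζ x y → Urel γ G ζ (σU g x) (σU g y))
    (σM : ↥G → ↥(MpSub γ G ζ) → ↥(MpSub γ G ζ))
    (hσMval : ∀ (g : ↥G) (m : ↥(MpSub γ G ζ)),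
      ((σM g m : ↥(Sp γ G ζ)) : Submodule ℂ (Fin n → ℂ)) =
        Submodule.map (Matrix.toLin' (matOf g))
          ((m : ↥(Sp γ G ζ)) : Submodule ℂ (Fin n → ℂ)))
    (σP : ∀ (g : ↥G) (m : ↥(MpSub γ G ζ)), SgtT γ G ζ m → SgtT γ G ζ (σM g m))
    (hσPval : ∀ (g : ↥G) (m : ↥(MpSub γ G ζ)) (E : SgtT γ G ζ m),
      ((σP g m E).1 : Submodule ℂ (Fin n → ℂ)) =
        Submodule.map (Matrix.toLin' (matOf g)) (E.1 : Submodule ℂ (Fin n → ℂ)))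
    (hσPmono : ∀ (g : ↥G) (m : ↥(MpSub γ G ζ)), ∀ ⦃x y : SgtT γ G ζ m⦄,
      rgtS γ G ζ m x y → rgtS γ G ζ (σM g m) (σP g m x) (σP g m y))
    (σstab : ∀ (m : ↥(MpSub γ G ζ)) (h : ↥G), h ∈ stabE m → SgtT γ G ζ m → SgtT γ G ζ m)
    (hσstabval : ∀ (m : ↥(MpSub γ G ζ)) (h : ↥G) (hh : h ∈ stabE m) (E : SgtT γ G ζ m),
      ((σstab m h hh E).1 : Submodule ℂ (Fin n → ℂ)) =
        Submodule.map (Matrix.toLin' (matOf h)) (E.1 : Submodule ℂ (Fin n → ℂ)))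
    (hσstabmono : ∀ (m : ↥(MpSub γ G ζ)) (h : ↥G) (hh : h ∈ stabE m),
      ∀ ⦃x y : SgtT γ G ζ m⦄,
        rgtS γ G ζ m x y → rgtS γ G ζ m (σstab m h hh x) (σstab m h hh y))
    (reps : Set ↥(MpSub γ G ζ))
    (htrans : ∀ m : ↥(MpSub γ G ζ), ∃! m₀ : ↥(MpSub γ G ζ), m₀ ∈ reps ∧
      ∃ g : ↥G, Submodule.map (Matrix.toLin' (matOf g))
          ((m : ↥(Sp γ G ζ)) : Submodule ℂ (Fin n → ℂ)) =
        ((m₀ : ↥(Sp γ G ζ)) : Submodule ℂ (Fin n → ℂ)))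
    (k : ℕ) :
    (∃ e1 : redH (Option ↥(Sp γ G ζ)) (Urel γ G ζ) (k + 1) ≃+
        ⨁ m : ↥(MpSub γ G ζ), redH (SgtT γ G ζ m) (rgtS γ G ζ m) k,
      ∀ (g : ↥G) (x : redH (Option ↥(Sp γ G ζ)) (Urel γ G ζ) (k + 1)),
        e1 (indH (rα := Urel γ G ζ) (rβ := Urel γ G ζ) (σU g) (hσUmono g) (k + 1) x) =
          DirectSum.toAddMonoid (fun m : ↥(MpSub γ G ζ) =>
            (DirectSum.of (fun m : ↥(MpSub γ G ζ) => redH (SgtT γ G ζ m) (rgtS γ G ζ m) k)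
                (σM g m)).comp
              (indH (rα := rgtS γ G ζ m) (rβ := rgtS γ G ζ (σM g m)) (σP g m)
                (hσPmono g m) k).toAddMonoidHom) (e1 x)) ∧
    (∃ e2 : (⨁ m : ↥(MpSub γ G ζ), redH (SgtT γ G ζ m) (rgtS γ G ζ m) k) ≃+
        ⨁ m₀ : ↥reps, ↥(IndSubG (stabE m₀.1)
          (fun h hh => (indH (rα := rgtS γ G ζ m₀.1) (rβ := rgtS γ G ζ m₀.1)
            (σstab m₀.1 h hh) (hσstabmono m₀.1 h hh) k).toAddMonoidHom)),
      ∀ (g : ↥G) (x : ⨁ m : ↥(MpSub γ G ζ), redH (SgtT γ G ζ m) (rgtS γ G ζ m) k),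
        e2 (DirectSum.toAddMonoid (fun m : ↥(MpSub γ G ζ) =>
            (DirectSum.of (fun m : ↥(MpSub γ G ζ) => redH (SgtT γ G ζ m) (rgtS γ G ζ m) k)
                (σM g m)).comp
              (indH (rα := rgtS γ G ζ m) (rβ := rgtS γ G ζ (σM g m)) (σP g m)
                (hσPmono g m) k).toAddMonoidHom) x) =
          DirectSum.toAddMonoid (fun m₀ : ↥reps =>
            (DirectSum.of (fun m₀ : ↥reps => ↥(IndSubG (stabE m₀.1)
                (fun h hh => (indH (rα := rgtS γ G ζ m₀.1) (rβ := rgtS γ G ζ m₀.1)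
                  (σstab m₀.1 h hh) (hσstabmono m₀.1 h hh) k).toAddMonoidHom))) m₀).comp
              (indTrans (stabE m₀.1)
                (fun h hh => (indH (rα := rgtS γ G ζ m₀.1) (rβ := rgtS γ G ζ m₀.1)
                  (σstab m₀.1 h hh) (hσstabmono m₀.1 h hh) k).toAddMonoidHom) g))
            (e2 x)) ∧
    (∃ e0 : redH (Option ↥(Sp γ G ζ)) (Urel γ G ζ) 0 ≃+
        ⨁ m : ↥(MpSub γ G ζ), redHneg (SgtT γ G ζ m) (rgtS γ G ζ m),
      ∀ (g : ↥G) (x : redH (Option ↥(Sp γ G ζ)) (Urel γ G ζ) 0),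
        e0 (indH (rα := Urel γ G ζ) (rβ := Urel γ G ζ) (σU g) (hσUmono g) 0 x) =
          DirectSum.toAddMonoid (fun m : ↥(MpSub γ G ζ) =>
            (DirectSum.of
                (fun m : ↥(MpSub γ G ζ) => redHneg (SgtT γ G ζ m) (rgtS γ G ζ m))
                (σM g m)).comp
              (indHneg (rα := rgtS γ G ζ m) (rβ := rgtS γ G ζ (σM g m)) (σP g m)
                (hσPmono g m)).toAddMonoidHom) (e0 x)) ∧
    (∃ e0' : (⨁ m : ↥(MpSub γ G ζ), redHneg (SgtT γ G ζ m) (rgtS γ G ζ m)) ≃+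
        ⨁ m₀ : ↥reps, ↥(IndSubG (stabE m₀.1)
          (fun h hh => (indHneg (rα := rgtS γ G ζ m₀.1) (rβ := rgtS γ G ζ m₀.1)
            (σstab m₀.1 h hh) (hσstabmono m₀.1 h hh)).toAddMonoidHom)),
      ∀ (g : ↥G) (x : ⨁ m : ↥(MpSub γ G ζ), redHneg (SgtT γ G ζ m) (rgtS γ G ζ m)),
        e0' (DirectSum.toAddMonoid (fun m : ↥(MpSub γ G ζ) =>
            (DirectSum.of
                (fun m : ↥(MpSub γ G ζ) => redHneg (SgtT γ G ζ m) (rgtS γ G ζ m))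
                (σM g m)).comp
              (indHneg (rα := rgtS γ G ζ m) (rβ := rgtS γ G ζ (σM g m)) (σP g m)
                (hσPmono g m)).toAddMonoidHom) x) =
          DirectSum.toAddMonoid (fun m₀ : ↥reps =>
            (DirectSum.of (fun m₀ : ↥reps => ↥(IndSubG (stabE m₀.1)
                (fun h hh => (indHneg (rα := rgtS γ G ζ m₀.1) (rβ := rgtS γ G ζ m₀.1)
                  (σstab m₀.1 h hh) (hσstabmono m₀.1 h hh)).toAddMonoidHom))) m₀).comp
              (indTrans (stabE m₀.1)
                (fun h hh => (indHneg (rα := rgtS γ G ζ m₀.1) (rβ := rgtS γ G ζ m₀.1)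
                  (σstab m₀.1 h hh) (hσstabmono m₀.1 h hh)).toAddMonoidHom) g))
            (e0' x)) := by
  have : Finite ↥(Sp γ G ζ) := (finite_Sp hG.1).to_subtype
  choose act hact hactv using hσUval
  let : MulAction ↥G ↥(Sp γ G ζ) :=
    { smul := act
      one_smul := fun E => Subtype.ext ((hactv 1 E).trans (map_matOf_one _))
      mul_smul := fun g h E => Subtype.ext (by
        change (act (g * h) E).1 = (act g (act h E)).1
        rw [hactv, hactv, hactv, map_matOf_mul]) }
  let : MulAction ↥G ↥(MpSub γ G ζ) :=
    { smul := σM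
      one_smul := fun m => Subtype.ext (Subtype.ext ((hσMval 1 m).trans (map_matOf_one _)))
      mul_smul := fun g h m => Subtype.ext (Subtype.ext (by
        change (σM (g * h) m).1.1 = (σM g (σM h m)).1.1
        rw [hσMval, hσMval, hσMval, map_matOf_mul])) }
  have hM : ∀ (g : ↥G) (m : ↥(MpSub γ G ζ)), (g • m).1 = g • m.1 := fun g m =>
    Subtype.ext ((hσMval g m).trans (hactv g m.1).symm)
  have hr : ∀ (g : ↥G) ⦃a b⦄, rSp γ G ζ a b → rSp γ G ζ (g • a) (g • b) := by
    intro g a b h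
    change (act g b).1 < (act g a).1
    rw [hactv, hactv]
    exact lt_of_le_of_ne (Submodule.map_mono h.le) fun e => h.ne (map_matOf_injective g e)
  have hτm : ∀ (g : ↥G) (m : ↥(MpSub γ G ζ)) a, σU g a = some (g • m).1 ↔ a = some m.1 := by
    rintro g m (_ | E)
    · simp [hσUnone]
    · rw [hact, hM]
      exact ⟨fun h => congrArg some (MulAction.injective g (Option.some_injective _ h)),
        fun h => congrArg (fun F => some (g • F)) (Option.some_injective _ h)⟩
  have hτφ : ∀ (g : ↥G) (m : ↥(MpSub γ G ζ)) (p : SgtT γ G ζ m),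
      σU g (some p.1) = some (σP g m p).1 := fun g m p =>
    (hact g p.1).trans (congrArg some (Subtype.ext ((hactv g p.1).trans (hσPval g m p).symm)))
  have hφv : ∀ (g : ↥G) (m : ↥(MpSub γ G ζ)) (p : SgtT γ G ζ m), (σP g m p).1 = g • p.1 :=
    fun g m p => Subtype.ext ((hσPval g m p).trans (hactv g p.1).symm)
  have hψv : ∀ (m : ↥(MpSub γ G ζ)) (h : ↥G) (hh : h ∈ stabE m) (p : SgtT γ G ζ m),
      (σstab m h hh p).1 = h • p.1 :=
    fun m h hh p => Subtype.ext ((hσstabval m h hh p).trans (hactv h p.1).symm)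
  have hval : ∀ (g : ↥G) (m m' : ↥(MpSub γ G ζ)),
      Submodule.map (Matrix.toLin' (matOf g)) m.1.1 = m'.1.1 ↔ g • m = m' := fun g m m' =>
    ⟨fun h => Subtype.ext (Subtype.ext ((hσMval g m).trans h)),
      fun h => h ▸ (hσMval g m).symm⟩
  have hstab : ∀ (m : ↥(MpSub γ G ζ)) (h : ↥G), h ∈ stabE m ↔ h • m = m :=
    fun m h => hval h m m
  have hreps : ∀ m : ↥(MpSub γ G ζ), ∃! m₀, m₀ ∈ reps ∧ ∃ g : ↥G, g • m = m₀ := by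
    simpa only [hval] using htrans
  refine ⟨?_, ?_, ?_, ?_⟩
  · exact exists_redH_extRel_directSum_equiv rSp_mem_Tp mem_MpSub_iff (Urel γ G ζ) Urel_eq_extRel
      σU hσUmono hτm σP hσPmono hτφ k
  · exact exists_directSum_redH_equiv_induced hM hr σP hσPmono hφv reps hreps stabE hstab
      σstab hσstabmono hψv k
  · exact exists_redH_zero_extRel_directSum_equiv rSp_mem_Tp mem_MpSub_iff (Urel γ G ζ)
      Urel_eq_extRel σU hσUmono hτm σP hσPmono hτφ
  · exact exists_directSum_redHneg_equiv_induced hM hr σP hσPmono hφv reps hreps stabE hstab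
      σstab hσstabmono hψv
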